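/- arXiv:0707.4261 — 3 statements merged into one kernel-verified Lean document; each statement's English description precedes it below -/
import Mathlib

section
/- Let u² and t be rational numbers with 0 < u² < t − 1 and let p be a prime. If either (v_p(t) ≥ 0 and v_p(u²) ≤ −2) or (v_p(t) < 0 and v_p(u²) ≤ 2·(v_p(t) − 1)), then the image of the finite cusp set C(Δ(u²,2t)) under the canonical embedding ℚ → ℚ_p is not dense in ℚ_p. -/
open Matrix

/-- The projective general linear group `PGL₂(ℚ)`. -/
abbrev PGL2Q : Type := GL (Fin 2) ℚ ⧸ Subgroup.center (GL (Fin 2) ℚ)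

/-- The canonical projection `GL₂(ℚ) → PGL₂(ℚ)`. -/
def pgl : GL (Fin 2) ℚ →* PGL2Q := QuotientGroup.mk' (Subgroup.center (GL (Fin 2) ℚ))

/-- The Möbius action of a matrix `A ∈ GL₂(ℚ)` on `ℙ¹(ℚ) = ℚ ∪ {∞}`. -/
def moebius (A : GL (Fin 2) ℚ) (z : OnePoint ℚ) : OnePoint ℚ :=
  Option.elim z
    (if A.val 1 0 = 0 then OnePoint.infty else ((A.val 0 0 / A.val 1 0 : ℚ) : OnePoint ℚ))
    (fun x => if A.val 1 0 * x + A.val 1 1 = 0 then OnePoint.infty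
      else (((A.val 0 0 * x + A.val 0 1) / (A.val 1 0 * x + A.val 1 1) : ℚ) : OnePoint ℚ))

/-- `Δ(u²,2t)`: the subgroup of `PGL₂(ℚ)` generated by the images of the matrices
`M₁ = [[t−1, u²],[1, 1]]` and `M₂ = [[u², u²],[1, t−u²]]`. -/
def Delta (u2 t : ℚ) : Subgroup PGL2Q :=
  Subgroup.closure (pgl ''
    {A : GL (Fin 2) ℚ | A.val = !![t - 1, u2; 1, 1] ∨ A.val = !![u2, u2; 1, t - u2]})

/-- The set `C(Γ)` of finite cusps of a subgroup `Γ ≤ PGL₂(ℚ)`: rationals fixed by a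
parabolic element of `Γ` (an element `γ ≠ 1` with `tr(A)² = 4·det(A)` for a representative
`A ∈ GL₂(ℚ)`). -/
def finiteCusps (Γ : Subgroup PGL2Q) : Set ℚ :=
  {x : ℚ | ∃ A : GL (Fin 2) ℚ, pgl A ∈ Γ ∧ pgl A ≠ 1 ∧
    (A.val.trace) ^ 2 = 4 * A.val.det ∧ moebius A (x : OnePoint ℚ) = (x : OnePoint ℚ)}

/-- The quadratic forms attached to the four letters of the free group on two generators. Each is
nonnegative on one of the closed arcs of `ℙ¹(ℝ)` cut out by `∞, -1, 0, a`, on homogeneous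
coordinates. -/
def arcForm (a : ℚ) : Bool × Bool → (Fin 2 → ℚ) → ℚ
  | (true, true), v => v 1 * (v 0 - a * v 1)
  | (true, false), v => -(v 0 * (v 0 + v 1))
  | (false, true), v => v 0 * (a * v 1 - v 0)
  | (false, false), v => -(v 1 * (v 0 + v 1))

/-- The arcs attached to different letters have disjoint interiors. -/
theorem arcForm_nonpos_of_ne {a : ℚ} (ha : 0 < a) {h k : Bool × Bool} (hk : h ≠ k)
    {v : Fin 2 → ℚ} (hv : 0 ≤ arcForm a h v) : arcForm a k v ≤ 0 := by
  rcases h with ⟨_ | _, _ | _⟩ <;> rcases k with ⟨_ | _, _ | _⟩ <;>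
    simp only [ne_eq, not_true_eq_false, arcForm] at hk hv ⊢ <;>
    generalize v 0 = x at hv ⊢ <;> generalize v 1 = y at hv ⊢
  · nlinarith [sq_nonneg x, sq_nonneg y, mul_nonneg ha.le hv, mul_nonneg ha.le (sq_nonneg y)]
  · nlinarith [sq_nonneg (x + y)]
  · nlinarith [sq_nonneg x, sq_nonneg y, mul_nonneg ha.le (sq_nonneg y)]
  · have : 0 ≤ x * y := nonneg_of_mul_nonneg_right (by nlinarith [sq_nonneg x] : 0 ≤ a * (x * y)) ha
    nlinarith [sq_nonneg y]
  · have : 0 ≤ x * y := nonneg_of_mul_nonneg_right (by nlinarith [sq_nonneg x] : 0 ≤ a * (x * y)) ha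
    nlinarith [sq_nonneg x]
  · have : a * (y * (x - a * y)) ≤ 0 := by nlinarith [sq_nonneg (x - a * y)]
    exact nonpos_of_mul_nonpos_right this ha
  · nlinarith [sq_nonneg (x + y)]
  · nlinarith [sq_nonneg x, sq_nonneg y, mul_nonneg ha.le hv, mul_nonneg ha.le (sq_nonneg x)]
  · nlinarith [sq_nonneg x, sq_nonneg y, mul_nonneg ha.le (sq_nonneg y)]
  · nlinarith [sq_nonneg y, mul_nonneg ha.le (sq_nonneg y)]
  · nlinarith [sq_nonneg (x - a * y), mul_nonneg ha.le hv]
  · nlinarith [sq_nonneg x, mul_nonneg ha.le (sq_nonneg y)]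

/-- The matrix attached to a letter of the free group on two generators. -/
def letterMatrix (M : Bool → GL (Fin 2) ℚ) (h : Bool × Bool) : GL (Fin 2) ℚ :=
  cond h.2 (M h.1) (M h.1)⁻¹

theorem GL_mulVec_inv_mulVec (g : GL (Fin 2) ℚ) (v : Fin 2 → ℚ) :
    g.val *ᵥ (g⁻¹.val *ᵥ v) = v := by
  rw [Matrix.mulVec_mulVec, ← Units.val_mul, mul_inv_cancel, Units.val_one, Matrix.one_mulVec]

theorem of_mulVec_apply_zero_one (A B C D : ℚ) (v : Fin 2 → ℚ) :
    (!![A, B; C, D] *ᵥ v) 0 = A * v 0 + B * v 1 ∧ (!![A, B; C, D] *ᵥ v) 1 = C * v 0 + D * v 1 := by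
  simp [Matrix.mulVec, dotProduct, Fin.sum_univ_two]

section PingPong

variable {a t : ℚ} {M : Bool → GL (Fin 2) ℚ}

/-- Each generator carries the complement of one arc into the arc paired with it. -/
theorem arcForm_generator (ha : 0 < a) (hat : a < t - 1)
    (h₁ : (M true).val = !![t - 1, a; 1, 1]) (h₂ : (M false).val = !![a, a; 1, t - a])
    (i : Bool) : ∃ c : ℚ, 0 < c ∧
      ∀ v, arcForm a (i, true) ((M i).val *ᵥ v) = -(c * arcForm a (i, false) v) := by
  cases i
  · refine ⟨a ^ 2 * (t - 1 - a), mul_pos (pow_pos ha 2) (by linarith), fun v => ?_⟩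
    simp only [arcForm, h₂, of_mulVec_apply_zero_one]
    ring
  · refine ⟨t - 1 - a, by linarith, fun v => ?_⟩
    simp only [arcForm, h₁, of_mulVec_apply_zero_one]
    ring

theorem arcForm_letterMatrix_nonneg (ha : 0 < a) (hat : a < t - 1)
    (h₁ : (M true).val = !![t - 1, a; 1, 1]) (h₂ : (M false).val = !![a, a; 1, t - a])
    (h : Bool × Bool) {v : Fin 2 → ℚ} (hv : arcForm a (h.1, !h.2) v ≤ 0) :
    0 ≤ arcForm a h ((letterMatrix M h).val *ᵥ v) := by
  obtain ⟨i, b⟩ := h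
  obtain ⟨c, hc, hM⟩ := arcForm_generator ha hat h₁ h₂ i
  cases b
  · have := hM ((M i)⁻¹.val *ᵥ v)
    rw [GL_mulVec_inv_mulVec] at this
    simp only [letterMatrix, cond_false, Bool.not_false] at hv ⊢
    exact nonneg_of_mul_nonneg_right (by linarith) hc
  · simp only [letterMatrix, cond_true, hM, Bool.not_true] at hv ⊢
    nlinarith

/-- Ping-pong for a reduced word. -/
theorem arcForm_prod_nonneg (ha : 0 < a) (hat : a < t - 1)
    (h₁ : (M true).val = !![t - 1, a; 1, 1]) (h₂ : (M false).val = !![a, a; 1, t - a])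
    (L : List (Bool × Bool)) (h : Bool × Bool) (hL : FreeGroup.IsReduced (h :: L))
    {v : Fin 2 → ℚ}
    (hv : ∀ k ∈ (h :: L).getLast?, arcForm a (k.1, !k.2) v ≤ 0) :
    0 ≤ arcForm a h (((h :: L).map (letterMatrix M)).prod.val *ᵥ v) := by
  induction L generalizing h with
  | nil =>
    simpa using arcForm_letterMatrix_nonneg ha hat h₁ h₂ h (hv h (by simp))
  | cons k L ih =>
    rw [List.map_cons, List.prod_cons, Units.val_mul, ← Matrix.mulVec_mulVec]
    rw [FreeGroup.IsReduced, List.isChain_cons_cons] at hL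
    refine arcForm_letterMatrix_nonneg ha hat h₁ h₂ h (arcForm_nonpos_of_ne ha ?_
      (ih k hL.2 (by simpa only [List.getLast?_cons_cons] using hv)))
    rintro rfl
    simpa using hL.1 rfl

/-- A cyclically reduced word preserves the arc attached to its first letter. -/
theorem arcForm_cyclicallyReduced (ha : 0 < a) (hat : a < t - 1)
    (h₁ : (M true).val = !![t - 1, a; 1, 1]) (h₂ : (M false).val = !![a, a; 1, t - a])
    {L : List (Bool × Bool)} {h : Bool × Bool} (hL : FreeGroup.IsCyclicallyReduced (h :: L))
    {v : Fin 2 → ℚ} (hv : 0 ≤ arcForm a h v) :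
    0 ≤ arcForm a h (((h :: L).map (letterMatrix M)).prod.val *ᵥ v) := by
  refine arcForm_prod_nonneg ha hat h₁ h₂ L h hL.1 fun k hk => arcForm_nonpos_of_ne ha ?_ hv
  have := hL.2 k hk h (by simp)
  rintro rfl
  simpa using this rfl

end PingPong

/-- If the nonnegative cone of an indefinite binary quadratic form is preserved by a nontrivial
transvection fixing `(x, 1)`, then the form vanishes at `(x, 1)`. -/
theorem eq_zero_of_transvection_preserves {A B C x c : ℚ} (hc : c ≠ 0)
    (hpres : ∀ y z : ℚ, 0 ≤ A * y ^ 2 + B * y * z + C * z ^ 2 →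
      0 ≤ A * (y + c * (y - x * z) * x) ^ 2 + B * (y + c * (y - x * z) * x) * (z + c * (y - x * z))
        + C * (z + c * (y - x * z)) ^ 2)
    (hneg : ∃ y z : ℚ, A * y ^ 2 + B * y * z + C * z ^ 2 < 0)
    (hpos : ∃ y z : ℚ, 0 < A * y ^ 2 + B * y * z + C * z ^ 2) :
    A * x ^ 2 + B * x + C = 0 := by
  set q := A * x ^ 2 + B * x + C with hq
  have iter : ∀ (n : ℕ) (y z : ℚ), 0 ≤ A * y ^ 2 + B * y * z + C * z ^ 2 →
      0 ≤ A * (y + n * c * (y - x * z) * x) ^ 2 +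
        B * (y + n * c * (y - x * z) * x) * (z + n * c * (y - x * z))
        + C * (z + n * c * (y - x * z)) ^ 2 := by
    intro n y z h
    induction n with
    | zero => simpa using h
    | succ n ih =>
      have := hpres _ _ ih
      push_cast
      ring_nf at this ⊢
      exact this
  have large : ∀ r s : ℚ, 0 < r → ∀ m : ℚ, ∃ n : ℕ, m < n * s + n ^ 2 * r := by
    intro r s hr m
    obtain ⟨n, hn⟩ := exists_nat_gt (max 1 ((|m| + |s|) / r))
    have h1 : (1 : ℚ) < n := (le_max_left _ _).trans_lt hn
    have h2 : |m| + |s| < n * r := (div_lt_iff₀ hr).1 ((le_max_right _ _).trans_lt hn)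
    refine ⟨n, ?_⟩
    have h3 : -|s| ≤ s := neg_abs_le s
    have h4 : m ≤ |m| := le_abs_self m
    have h5 := abs_nonneg m
    have h6 : |m| < n * (s + n * r) := by nlinarith
    nlinarith
  rcases lt_trichotomy q 0 with h | h | h
  · exfalso
    obtain ⟨y, z, hyz⟩ := hpos
    have hl : y - x * z ≠ 0 := by
      intro h0
      obtain rfl : y = x * z := by linarith
      nlinarith [mul_nonneg (neg_nonneg.2 h.le) (sq_nonneg z)]
    have hr : 0 < -(q * (c * (y - x * z)) ^ 2) := by
      have : 0 < (c * (y - x * z)) ^ 2 := by positivity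
      nlinarith
    obtain ⟨n, hn⟩ := large _ (-(c * (y - x * z) * (2 * A * x * y + B * (y + x * z) + 2 * C * z))) hr
      (A * y ^ 2 + B * y * z + C * z ^ 2)
    have := iter n y z hyz.le
    rw [hq] at hn
    linarith
  · exact h
  · exfalso
    obtain ⟨y, z, hyz⟩ := hneg
    have hl : y - x * z ≠ 0 := by
      intro h0
      obtain rfl : y = x * z := by linarith
      nlinarith [mul_nonneg h.le (sq_nonneg z)]
    have hr : 0 < q * (c * (y - x * z)) ^ 2 := by positivity
    obtain ⟨n, hn⟩ := large _ (-(c * (y - x * z) * (2 * A * x * y + B * (y + x * z) + 2 * C * z))) hr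
      (-(A * y ^ 2 + B * y * z + C * z ^ 2))
    have := iter n (y - n * c * (y - x * z) * x) (z - n * c * (y - x * z)) (by
      rw [hq] at hn
      linarith)
    ring_nf at this hyz
    linarith

/-- A non-scalar invertible `2 × 2` matrix with `tr² = 4 det` fixing `(x, 1)` up to scaling is a
multiple of a transvection. -/
theorem exists_transvection_of_parabolic (g : GL (Fin 2) ℚ)
    (hg : g ∉ Subgroup.center (GL (Fin 2) ℚ)) (hpar : g.val.trace ^ 2 = 4 * g.val.det)
    {e : Fin 2 → ℚ} (he : e 1 ≠ 0) {m : ℚ} (hge : g.val *ᵥ e = m • e) :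
    ∃ l c : ℚ, l ≠ 0 ∧ c ≠ 0 ∧ ∀ v,
      (g.val *ᵥ v) 0 = l * (v 0 + c * (v 0 - e 0 / e 1 * v 1) * (e 0 / e 1)) ∧
      (g.val *ᵥ v) 1 = l * (v 1 + c * (v 0 - e 0 / e 1 * v 1)) := by
  have hdet : g.val.det ≠ 0 := (Matrix.isUnits_det_units g).ne_zero
  have hsc : ∀ l : ℚ, g.val ≠ Matrix.scalar (Fin 2) l := fun l hl =>
    hg (Matrix.GeneralLinearGroup.mem_center_iff_val_mem_range_scalar.2 ⟨l, hl.symm⟩)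
  obtain ⟨x, hx⟩ : ∃ x, x = e 0 / e 1 := ⟨_, rfl⟩
  have hx0 : e 0 = x * e 1 := by rw [hx]; field_simp
  rw [← hx]
  have e0 := congrFun hge 0
  have e1 := congrFun hge 1
  generalize g.val = G at *
  rw [Matrix.eta_fin_two G] at e0 e1 hsc hpar hdet ⊢
  simp only [of_mulVec_apply_zero_one, Pi.smul_apply, smul_eq_mul, hx0] at e0 e1 ⊢
  simp only [Matrix.trace_fin_two_of, Matrix.det_fin_two_of] at hpar hdet
  generalize G 0 0 = A at *
  generalize G 0 1 = B at *
  generalize G 1 0 = C at *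
  generalize G 1 1 = D at *
  replace e0 : A * x + B = m * x := mul_right_cancel₀ he (by linarith)
  replace e1 : C * x + D = m := mul_right_cancel₀ he (by linarith)
  obtain rfl : B = (m - A) * x := by linarith
  obtain rfl : D = m - C * x := by linarith
  have hm : m = A - C * x := by
    have : (A - C * x - m) ^ 2 = 0 := by nlinarith
    have := pow_eq_zero_iff (two_ne_zero) |>.1 this
    linarith
  subst hm
  have hl : A - C * x ≠ 0 := by
    intro h
    apply hdet
    nlinarith
  have hC : C ≠ 0 := by
    rintro rfl
    apply hsc A
    ext i j
    fin_cases i <;> fin_cases j <;> simp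
  refine ⟨A - C * x, C / (A - C * x), hl, div_ne_zero hC hl, fun v => ⟨?_, ?_⟩⟩
  · field_simp
    ring
  · field_simp
    ring

/-- A parabolic matrix preserving an arc fixes an end point of it. -/
theorem arcForm_eq_zero_of_parabolic {a : ℚ} (ha : 0 < a) (h : Bool × Bool) (g : GL (Fin 2) ℚ)
    (hg : g ∉ Subgroup.center (GL (Fin 2) ℚ)) (hpar : g.val.trace ^ 2 = 4 * g.val.det)
    {e : Fin 2 → ℚ} (he : e 1 ≠ 0) {m : ℚ} (hge : g.val *ᵥ e = m • e)
    (hpres : ∀ v, 0 ≤ arcForm a h v → 0 ≤ arcForm a h (g.val *ᵥ v)) :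
    arcForm a h e = 0 := by
  obtain ⟨l, c, hl, hc, hgv⟩ := exists_transvection_of_parabolic g hg hpar he hge
  obtain ⟨A, B, C, hABC, hneg, hpos⟩ : ∃ A B C : ℚ,
      (∀ v, arcForm a h v = A * v 0 ^ 2 + B * v 0 * v 1 + C * v 1 ^ 2) ∧
      (∃ y z : ℚ, A * y ^ 2 + B * y * z + C * z ^ 2 < 0) ∧
      (∃ y z : ℚ, 0 < A * y ^ 2 + B * y * z + C * z ^ 2) := by
    rcases h with ⟨_ | _, _ | _⟩
    · exact ⟨0, -1, -1, fun v => by simp only [arcForm]; ring, ⟨0, 1, by norm_num⟩,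
        ⟨-2, 1, by norm_num⟩⟩
    · exact ⟨-1, a, 0, fun v => by simp only [arcForm]; ring, ⟨1, 0, by norm_num⟩,
        ⟨a, 2, by nlinarith⟩⟩
    · exact ⟨-1, -1, 0, fun v => by simp only [arcForm]; ring, ⟨1, 0, by norm_num⟩,
        ⟨-1, 2, by norm_num⟩⟩
    · exact ⟨0, 1, -a, fun v => by simp only [arcForm]; ring, ⟨0, 1, by nlinarith⟩,
        ⟨a + 1, 1, by nlinarith⟩⟩
  have key := eq_zero_of_transvection_preserves (A := A) (B := B) (C := C) (x := e 0 / e 1) hc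
    (fun y z hyz => by
      have := hpres ![y, z] (by rw [hABC]; simpa using hyz)
      rw [hABC, (hgv _).1, (hgv _).2] at this
      simp only [Matrix.cons_val_zero, Matrix.cons_val_one] at this
      refine nonneg_of_mul_nonneg_right (a := l ^ 2) ?_ (by positivity)
      linarith) hneg hpos
  rw [hABC]
  field_simp at key
  linarith

section Annulus

variable (p : ℕ) [Fact p.Prime]

/-- Homogeneous coordinates of the `p`-adic annulus `T < |x| < |a| / T`. -/
def InAnnulus (T : ℝ) (a : ℚ) (v : Fin 2 → ℚ) : Prop :=
  T * ‖(v 1 : ℚ_[p])‖ < ‖(v 0 : ℚ_[p])‖ ∧ T * ‖(v 0 : ℚ_[p])‖ < ‖(a : ℚ_[p])‖ * ‖(v 1 : ℚ_[p])‖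

variable {p}

theorem padicNorm_add_eq_left {x y : ℚ_[p]} (h : ‖y‖ < ‖x‖) : ‖x + y‖ = ‖x‖ := by
  rw [Padic.add_eq_max_of_ne h.ne', max_eq_left h.le]

theorem padicNorm_add_eq_right {x y : ℚ_[p]} (h : ‖x‖ < ‖y‖) : ‖x + y‖ = ‖y‖ := by
  rw [add_comm, padicNorm_add_eq_left h]

theorem InAnnulus.of_smul {T : ℝ} {a c : ℚ} {v : Fin 2 → ℚ} (hc : c ≠ 0)
    (h : InAnnulus p T a (c • v)) : InAnnulus p T a v := by
  have hc' : 0 < ‖(c : ℚ_[p])‖ := norm_pos_iff.2 (Rat.cast_ne_zero.2 hc)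
  simp only [InAnnulus, Pi.smul_apply, smul_eq_mul, Rat.cast_mul, norm_mul] at h
  exact ⟨lt_of_mul_lt_mul_left (by linarith [h.1]) hc'.le,
    lt_of_mul_lt_mul_left (by linarith [h.2]) hc'.le⟩

variable {T : ℝ} {a t : ℚ} {M : Bool → GL (Fin 2) ℚ}

theorem InAnnulus.letterMatrix_mulVec (hT : 1 ≤ T) (ht : ‖(t : ℚ_[p])‖ ≤ T) (ha : 0 < a)
    (hat : a < t - 1)
    (h₁ : (M true).val = !![t - 1, a; 1, 1]) (h₂ : (M false).val = !![a, a; 1, t - a])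
    {v : Fin 2 → ℚ} (hv : InAnnulus p T a v) (h : Bool × Bool) :
    InAnnulus p T a ((letterMatrix M h).val *ᵥ v) := by
  obtain ⟨hv1, hv2⟩ := hv
  have hap : 0 < ‖(a : ℚ_[p])‖ := norm_pos_iff.2 (Rat.cast_ne_zero.2 ha.ne')
  have n0 := norm_nonneg (v 0 : ℚ_[p])
  have n1 := norm_nonneg (v 1 : ℚ_[p])
  have l1 : ‖(v 1 : ℚ_[p])‖ < ‖(v 0 : ℚ_[p])‖ := by nlinarith
  have l2 : ‖(v 0 : ℚ_[p])‖ < ‖(a : ℚ_[p])‖ * ‖(v 1 : ℚ_[p])‖ := by nlinarith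
  have p1 : 0 < ‖(v 1 : ℚ_[p])‖ := by
    rcases n1.eq_or_lt with h | h
    · rw [← h] at l2 hv2
      nlinarith
    · exact h
  have hTa : T < ‖(a : ℚ_[p])‖ := by
    have : T * ‖(v 1 : ℚ_[p])‖ < ‖(a : ℚ_[p])‖ * ‖(v 1 : ℚ_[p])‖ := by nlinarith
    exact lt_of_mul_lt_mul_right this n1
  have ht1 : ‖(t : ℚ_[p]) - 1‖ ≤ T := by
    rw [sub_eq_add_neg]
    refine (Padic.nonarchimedean _ _).trans ?_
    rw [norm_neg, norm_one]
    exact max_le ht hT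
  have hta : ‖(t : ℚ_[p]) - a‖ = ‖(a : ℚ_[p])‖ := by
    rw [sub_eq_add_neg, padicNorm_add_eq_right, norm_neg]
    rw [norm_neg]
    linarith
  have s1 : ‖(v 0 : ℚ_[p]) + v 1‖ = ‖(v 0 : ℚ_[p])‖ := padicNorm_add_eq_left l1
  have s2 : ‖-(v 0 : ℚ_[p]) + (t - 1) * v 1‖ = ‖(v 0 : ℚ_[p])‖ := by
    rw [padicNorm_add_eq_left, norm_neg]
    rw [norm_neg, norm_mul]
    nlinarith
  have s3 : ‖((t : ℚ_[p]) - 1) * v 0 + a * v 1‖ = ‖(a : ℚ_[p])‖ * ‖(v 1 : ℚ_[p])‖ := by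
    rw [padicNorm_add_eq_right, norm_mul]
    rw [norm_mul, norm_mul]
    nlinarith
  have s4 : ‖(v 0 : ℚ_[p]) + (t - a) * v 1‖ = ‖(a : ℚ_[p])‖ * ‖(v 1 : ℚ_[p])‖ := by
    rw [padicNorm_add_eq_right, norm_mul, hta]
    rwa [norm_mul, hta]
  have s5 : ‖(v 0 : ℚ_[p]) - a * v 1‖ = ‖(a : ℚ_[p])‖ * ‖(v 1 : ℚ_[p])‖ := by
    rw [sub_eq_add_neg, padicNorm_add_eq_right, norm_neg, norm_mul]
    rwa [norm_neg, norm_mul]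
  have s6 : ‖((t : ℚ_[p]) - a) * v 0 - a * v 1‖ = ‖(a : ℚ_[p])‖ * ‖(v 0 : ℚ_[p])‖ := by
    rw [sub_eq_add_neg, padicNorm_add_eq_left, norm_mul, hta]
    rw [norm_neg, norm_mul, norm_mul, hta]
    exact mul_lt_mul_of_pos_left l1 hap
  have w1 := mul_lt_mul_of_pos_left hv1 hap
  have w2 := mul_lt_mul_of_pos_left hv2 hap
  have hd : t - 1 - a ≠ 0 := by linarith
  rcases h with ⟨_ | _, _ | _⟩ <;> simp only [letterMatrix, cond_true, cond_false]
  · have key := GL_mulVec_inv_mulVec (M false) v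
    set w := (M false)⁻¹.val *ᵥ v
    have k0 := congrFun key 0
    have k1 := congrFun key 1
    simp only [h₂, of_mulVec_apply_zero_one] at k0 k1
    refine InAnnulus.of_smul (c := a * (t - 1 - a)) (mul_ne_zero ha.ne' hd) ?_
    have c0 : a * (t - 1 - a) * w 0 = (t - a) * v 0 - a * v 1 := by rw [← k0, ← k1]; ring
    have c1 : a * (t - 1 - a) * w 1 = -(v 0 - a * v 1) := by rw [← k0, ← k1]; ring
    simp only [InAnnulus, Pi.smul_apply, smul_eq_mul, c0, c1]
    push_cast
    rw [norm_neg, s5, s6]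
    constructor <;> linarith
  · simp only [InAnnulus, h₂, of_mulVec_apply_zero_one]
    rw [← mul_add, one_mul]
    push_cast
    rw [norm_mul, s1, s4]
    constructor <;> linarith
  · have key := GL_mulVec_inv_mulVec (M true) v
    set w := (M true)⁻¹.val *ᵥ v
    have k0 := congrFun key 0
    have k1 := congrFun key 1
    simp only [h₁, of_mulVec_apply_zero_one] at k0 k1
    refine InAnnulus.of_smul (c := t - 1 - a) hd ?_
    have c0 : (t - 1 - a) * w 0 = v 0 - a * v 1 := by rw [← k0, ← k1]; ring
    have c1 : (t - 1 - a) * w 1 = -v 0 + (t - 1) * v 1 := by rw [← k0, ← k1]; ring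
    simp only [InAnnulus, Pi.smul_apply, smul_eq_mul, c0, c1]
    push_cast
    rw [s5, s2]
    constructor <;> linarith
  · simp only [InAnnulus, h₁, of_mulVec_apply_zero_one, one_mul]
    push_cast
    rw [s1, s3]
    constructor <;> linarith

theorem InAnnulus.prod_mulVec (hT : 1 ≤ T) (ht : ‖(t : ℚ_[p])‖ ≤ T) (ha : 0 < a)
    (hat : a < t - 1)
    (h₁ : (M true).val = !![t - 1, a; 1, 1]) (h₂ : (M false).val = !![a, a; 1, t - a])
    {v : Fin 2 → ℚ} (hv : InAnnulus p T a v) (L : List (Bool × Bool)) :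
    InAnnulus p T a ((L.map (letterMatrix M)).prod.val *ᵥ v) := by
  induction L with
  | nil => simpa using hv
  | cons h L ih =>
    rw [List.map_cons, List.prod_cons, Units.val_mul, ← Matrix.mulVec_mulVec]
    exact ih.letterMatrix_mulVec hT ht ha hat h₁ h₂ h

/-- On the annulus none of the arc forms vanishes. -/
theorem InAnnulus.arcForm_ne_zero (hT : 1 ≤ T) {v : Fin 2 → ℚ} (hv : InAnnulus p T a v)
    (h : Bool × Bool) : arcForm a h v ≠ 0 := by
  obtain ⟨hv1, hv2⟩ := hv
  have n0 := norm_nonneg (v 0 : ℚ_[p])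
  have n1 := norm_nonneg (v 1 : ℚ_[p])
  have l1 : ‖(v 1 : ℚ_[p])‖ < ‖(v 0 : ℚ_[p])‖ := by nlinarith
  have l2 : ‖(v 0 : ℚ_[p])‖ < ‖(a : ℚ_[p])‖ * ‖(v 1 : ℚ_[p])‖ := by nlinarith
  have z0 : v 0 ≠ 0 := by
    intro h
    rw [h, Rat.cast_zero, norm_zero] at l1
    linarith
  have z1 : v 1 ≠ 0 := by
    intro h
    rw [h, Rat.cast_zero, norm_zero] at l2
    linarith
  have z2 : v 0 + v 1 ≠ 0 := by
    intro h
    rw [eq_neg_of_add_eq_zero_left h, Rat.cast_neg, norm_neg] at l1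
    exact l1.false
  have z3 : v 0 - a * v 1 ≠ 0 := by
    intro h
    rw [sub_eq_zero.1 h, Rat.cast_mul, norm_mul] at l2
    exact l2.false
  rcases h with ⟨_ | _, _ | _⟩ <;> simp only [arcForm]
  · exact neg_ne_zero.2 (mul_ne_zero z1 z2)
  · exact mul_ne_zero z0 (by rwa [← neg_sub, neg_ne_zero])
  · exact neg_ne_zero.2 (mul_ne_zero z0 z2)
  · exact mul_ne_zero z1 z3

/-- No parabolic element of the group generated by `M` fixes a point of the annulus. -/
theorem InAnnulus.not_parabolic_fixed (hT : 1 ≤ T) (ht : ‖(t : ℚ_[p])‖ ≤ T) (ha : 0 < a)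
    (hat : a < t - 1)
    (h₁ : (M true).val = !![t - 1, a; 1, 1]) (h₂ : (M false).val = !![a, a; 1, t - a])
    {v : Fin 2 → ℚ} (hv : InAnnulus p T a v) (w : FreeGroup Bool)
    (hw : FreeGroup.lift M w ∉ Subgroup.center (GL (Fin 2) ℚ))
    (hpar : (FreeGroup.lift M w).val.trace ^ 2 = 4 * (FreeGroup.lift M w).val.det)
    {m : ℚ} (hfix : (FreeGroup.lift M w).val *ᵥ v = m • v) : False := by
  have lift_mk : ∀ L, FreeGroup.lift M (FreeGroup.mk L) = (L.map (letterMatrix M)).prod :=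
    fun L => FreeGroup.lift_mk
  set K := FreeGroup.reduceCyclically.conjugator w.toWord
  set R := FreeGroup.reduceCyclically w.toWord
  have hwc : w = FreeGroup.mk K * FreeGroup.mk R * (FreeGroup.mk K)⁻¹ := by
    rw [FreeGroup.inv_mk, FreeGroup.mul_mk, FreeGroup.mul_mk,
      FreeGroup.reduceCyclically.conj_conjugator_reduceCyclically, FreeGroup.mk_toWord]
  have hR : FreeGroup.IsCyclicallyReduced R :=
    FreeGroup.reduceCyclically.isCyclicallyReduced FreeGroup.isReduced_toWord
  set k := FreeGroup.lift M (FreeGroup.mk K) with hk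
  set r := FreeGroup.lift M (FreeGroup.mk R) with hr
  have hg : FreeGroup.lift M w = k * r * k⁻¹ := by
    rw [hwc, map_mul, map_mul, map_inv]
  rw [hg] at hw hpar hfix
  have hrc : r ∉ Subgroup.center (GL (Fin 2) ℚ) := fun h =>
    hw (Subgroup.Normal.conj_mem inferInstance r h k)
  have hcan : k⁻¹.val * k.val = 1 := by rw [← Units.val_mul, inv_mul_cancel, Units.val_one]
  have hrpar : r.val.trace ^ 2 = 4 * r.val.det := by
    rw [Units.val_mul, Units.val_mul, Matrix.trace_mul_comm, Matrix.det_mul_comm, ← mul_assoc,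
      hcan, one_mul] at hpar
    exact hpar
  have he : InAnnulus p T a (k⁻¹.val *ᵥ v) := by
    rw [hk, ← map_inv, FreeGroup.inv_mk, lift_mk]
    exact hv.prod_mulVec hT ht ha hat h₁ h₂ _
  have hre : r.val *ᵥ (k⁻¹.val *ᵥ v) = m • (k⁻¹.val *ᵥ v) := by
    rw [← Matrix.mulVec_smul, ← hfix, Units.val_mul, Units.val_mul]
    simp only [Matrix.mulVec_mulVec, ← mul_assoc]
    rw [hcan, one_mul]
  rw [lift_mk] at hr
  generalize R = R' at hR hr
  cases R' with
  | nil => exact hrc (by rw [hr]; exact Subgroup.one_mem _)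
  | cons h L =>
    refine he.arcForm_ne_zero hT h (arcForm_eq_zero_of_parabolic ha h r hrc hrpar ?_ hre ?_)
    · intro h0
      have := he.2
      rw [h0, Rat.cast_zero, norm_zero, mul_zero] at this
      nlinarith [norm_nonneg (((k⁻¹.val *ᵥ v) 0 : ℚ) : ℚ_[p])]
    · intro v hv
      rw [hr]
      exact arcForm_cyclicallyReduced ha hat h₁ h₂ hR hv

end Annulus

/-- The annulus contains no finite cusp. -/
theorem not_inAnnulus_of_mem_finiteCusps {u2 t : ℚ} (h0 : 0 < u2) (h1 : u2 < t - 1)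
    (p : ℕ) [Fact p.Prime] {T : ℝ} (hT : 1 ≤ T) (ht : ‖(t : ℚ_[p])‖ ≤ T) {x : ℚ}
    (hx : x ∈ finiteCusps (Delta u2 t)) : ¬ InAnnulus p T u2 ![x, 1] := by
  intro hv
  obtain ⟨A, hA, hA1, hpar, hfix⟩ := hx
  have hd : t - 1 - u2 ≠ 0 := by linarith
  let M : Bool → GL (Fin 2) ℚ := fun i => cond i
    (Matrix.GeneralLinearGroup.mkOfDetNeZero !![t - 1, u2; 1, 1]
      (by rw [Matrix.det_fin_two_of]; simpa using hd))
    (Matrix.GeneralLinearGroup.mkOfDetNeZero !![u2, u2; 1, t - u2] (by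
      rw [Matrix.det_fin_two_of]
      have : u2 * (t - u2) - u2 * 1 = u2 * (t - 1 - u2) := by ring
      rw [this]
      exact mul_ne_zero h0.ne' hd))
  have hM₁ : (M true).val = !![t - 1, u2; 1, 1] := rfl
  have hM₂ : (M false).val = !![u2, u2; 1, t - u2] := rfl
  have hrange : Delta u2 t = Subgroup.map pgl (FreeGroup.lift M).range := by
    rw [FreeGroup.range_lift_eq_closure, MonoidHom.map_closure, Delta]
    congr 2
    ext B
    simp only [Set.mem_ofPred_eq, Set.mem_range, Bool.exists_bool, Units.ext_iff, hM₁, hM₂]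
    tauto
  rw [hrange] at hA
  obtain ⟨-, ⟨w, rfl⟩, hw⟩ := hA
  obtain ⟨z, hz, hzA⟩ : ∃ z ∈ Subgroup.center (GL (Fin 2) ℚ), A * z = FreeGroup.lift M w :=
    ⟨A⁻¹ * FreeGroup.lift M w, QuotientGroup.eq.1 hw.symm, mul_inv_cancel_left _ _⟩
  obtain ⟨s, hs⟩ := Matrix.GeneralLinearGroup.mem_center_iff_val_mem_range_scalar.1 hz
  have hval : (FreeGroup.lift M w).val = s • A.val := by
    rw [← hzA, Units.val_mul, ← hs, Matrix.scalar_apply, ← Matrix.smul_one_eq_diagonal,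
      Matrix.mul_smul, mul_one]
  obtain ⟨m, hm⟩ : ∃ m : ℚ, A.val *ᵥ ![x, 1] = m • ![x, 1] := by
    refine ⟨A.val 1 0 * x + A.val 1 1, ?_⟩
    change (if A.val 1 0 * x + A.val 1 1 = 0 then OnePoint.infty
      else (((A.val 0 0 * x + A.val 0 1) / (A.val 1 0 * x + A.val 1 1) : ℚ) : OnePoint ℚ)) = x
      at hfix
    split_ifs at hfix with hne
    · exact absurd hfix (OnePoint.infty_ne_coe x)
    · have := OnePoint.coe_injective hfix
      rw [div_eq_iff hne] at this
      ext i
      fin_cases i <;> simp [Matrix.mulVec, dotProduct, Fin.sum_univ_two]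
      linarith
  refine hv.not_parabolic_fixed hT ht h0 h1 hM₁ hM₂ w (m := s * m) ?_ ?_ ?_
  · intro hc
    exact hA1 (by rw [← hw]; exact (QuotientGroup.eq_one_iff _).2 hc)
  · rw [hval, Matrix.trace_smul, Matrix.det_smul, Fintype.card_fin, smul_eq_mul, mul_pow, hpar]
    ring
  · rw [hval, Matrix.smul_mulVec, hm, smul_smul]

theorem norm_ratCast_eq_zpow (p : ℕ) [Fact p.Prime] {x : ℚ} (hx : x ≠ 0) :
    ‖(x : ℚ_[p])‖ = (p : ℝ) ^ (-padicValRat p x) := by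
  rw [Padic.norm_eq_zpow_neg_valuation (by exact_mod_cast hx), Padic.valuation_ratCast]

/-- **Proposition 3.** Let `0 < u² < t − 1` and let `p` be a prime. If
`v_p(t) ≥ 0` and `v_p(u²) ≤ −2`, or if `v_p(t) < 0` and `v_p(u²) ≤ 2(v_p(t) − 1)`, then the
finite cusp set of `Δ(u²,2t)` is not dense in `ℚ_p`. -/
theorem cusps_not_dense_padic (u2 t : ℚ) (h0 : 0 < u2) (h1 : u2 < t - 1)
    (p : ℕ) [Fact p.Prime]
    (hval : (0 ≤ padicValRat p t ∧ padicValRat p u2 ≤ -2) ∨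
      (padicValRat p t < 0 ∧ padicValRat p u2 ≤ 2 * (padicValRat p t - 1))) :
    ¬ Dense ((fun x : ℚ => (x : ℚ_[p])) '' finiteCusps (Delta u2 t)) := by
  have hp : (1 : ℝ) < p := by exact_mod_cast (Fact.out : p.Prime).one_lt
  have hp0 : (0 : ℝ) < p := by linarith
  have ht0 : t ≠ 0 := by linarith
  obtain ⟨n, hn0, hnt, hna⟩ : ∃ n : ℤ, 0 ≤ n ∧ -padicValRat p t ≤ n ∧
      2 * n + 2 ≤ -padicValRat p u2 := by
    rcases hval with ⟨h, h'⟩ | ⟨h, h'⟩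
    · exact ⟨0, by omega, by omega, by omega⟩
    · exact ⟨-padicValRat p t, by omega, by omega, by omega⟩
  set T : ℝ := (p : ℝ) ^ n with hTdef
  have hT : 1 ≤ T := one_le_zpow₀ hp.le hn0
  have ht : ‖(t : ℚ_[p])‖ ≤ T := by
    rw [norm_ratCast_eq_zpow p ht0]
    exact zpow_le_zpow_right₀ hp.le hnt
  intro hdense
  let U : Set ℚ_[p] := {y | T < ‖y‖ ∧ T * ‖y‖ < ‖(u2 : ℚ_[p])‖}
  have hU : IsOpen U := (isOpen_lt continuous_const continuous_norm).inter
    (isOpen_lt (continuous_const.mul continuous_norm) continuous_const)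
  have hne : U.Nonempty := by
    refine ⟨(p : ℚ_[p]) ^ (-(n + 1)), ?_, ?_⟩ <;>
      rw [Padic.norm_p_zpow, neg_neg]
    · exact zpow_lt_zpow_right₀ hp (by omega)
    · rw [norm_ratCast_eq_zpow p h0.ne', hTdef, ← zpow_add₀ hp0.ne']
      exact zpow_lt_zpow_right₀ hp (by omega)
  obtain ⟨-, hy, ⟨x, hx, rfl⟩⟩ := hdense.inter_open_nonempty U hU hne
  refine not_inAnnulus_of_mem_finiteCusps h0 h1 p hT ht hx ⟨?_, ?_⟩
  · simpa using hy.1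
  · simpa using hy.2
end

section
/- Let t be an integer and u² a rational number with 0 < u² < t − 1. If the finite cusp set C(Δ(u²,2t)) equals all of ℚ (in particular, if Δ(u²,2t) is pseudomodular), then the denominator of u² is either 1 or a prime number. -/
open Matrix

/-- The rationals `r / s` in lowest terms for which `gcd s d` is neither `1` nor `d`; the fraction
need only be reduced at the primes dividing `d`. -/
def intermediateLevel (d : ℕ) : Set ℚ :=
  {x | ∃ r s : ℤ, x = r / s ∧ (∀ p : ℤ, Prime p → p ∣ d → p ∣ r → ¬ p ∣ s) ∧
    Int.gcd s d ≠ 1 ∧ Int.gcd s d ≠ d}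

lemma ne_zero_of_gcd_ne {d : ℕ} {s : ℤ} (h : Int.gcd s d ≠ d) : s ≠ 0 := by
  rintro rfl
  simp at h

lemma Prime.not_dvd_of_isCoprime {p a d : ℤ} (hp : Prime p) (had : IsCoprime a d) (hpd : p ∣ d) :
    ¬ p ∣ a :=
  fun hpa => hp.not_isUnit (had.isUnit_of_dvd' hpa hpd)

/-- Matrices in `Γ₀(d)` (up to determinants prime to `d`) preserve `intermediateLevel d`. -/
lemma intermediateLevel_gammaZero {d : ℕ} {α β γ δ : ℤ} (hα : IsCoprime α d) (hδ : IsCoprime δ d)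
    {x : ℚ} (hx : x ∈ intermediateLevel d) :
    d * γ * x + δ ≠ 0 ∧ (α * x + β) / (d * γ * x + δ) ∈ intermediateLevel d := by
  obtain ⟨r, s, rfl, hrs, h1, hd⟩ := hx
  have hs : (s : ℚ) ≠ 0 := by exact_mod_cast ne_zero_of_gcd_ne hd
  have hgcd : Int.gcd (d * γ * r + δ * s) d = Int.gcd s d := by
    have hdvd : ∀ k : ℤ, k ∣ d → (k ∣ d * γ * r + δ * s ↔ k ∣ s) := fun k hk => by
      rw [mul_assoc, dvd_add_right (hk.mul_right _)]
      exact ⟨(hδ.of_isCoprime_of_dvd_right hk).symm.dvd_of_dvd_mul_left, fun h => h.mul_left _⟩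
    apply Nat.dvd_antisymm
    · exact Int.dvd_gcd ((hdvd _ (Int.gcd_dvd_right _ _)).1 (Int.gcd_dvd_left _ _)) (Int.gcd_dvd_right _ _)
    · exact Int.dvd_gcd ((hdvd _ (Int.gcd_dvd_right _ _)).2 (Int.gcd_dvd_left _ _)) (Int.gcd_dvd_right _ _)
  have hs' : ((d * γ * r + δ * s : ℤ) : ℚ) ≠ 0 := by
    exact_mod_cast ne_zero_of_gcd_ne (hgcd ▸ hd)
  have hden : d * γ * ((r : ℚ) / s) + δ = (d * γ * r + δ * s : ℤ) / s := by
    push_cast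
    field_simp
  refine ⟨hden ▸ div_ne_zero hs' hs, α * r + β * s, d * γ * r + δ * s, ?_, ?_, hgcd ▸ h1,
    hgcd ▸ hd⟩
  · rw [hden]
    push_cast at hs' ⊢
    field_simp
  · intro p hp hpd hr hs
    rw [mul_assoc, dvd_add_right (hpd.mul_right _)] at hs
    have hps := (hp.dvd_or_dvd hs).resolve_left (hp.not_dvd_of_isCoprime hδ hpd)
    rw [dvd_add_left (hps.mul_left _)] at hr
    exact hrs p hp hpd ((hp.dvd_or_dvd hr).resolve_left (hp.not_dvd_of_isCoprime hα hpd)) hps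

/-- Matrices of Atkin–Lehner type at all primes dividing `d` preserve `intermediateLevel d`. -/
lemma intermediateLevel_atkinLehner {d : ℕ} (hd0 : d ≠ 0) {α β γ δ : ℤ} (hβ : IsCoprime β d)
    (hγ : IsCoprime γ d) {x : ℚ} (hx : x ∈ intermediateLevel d) :
    γ * x + δ ≠ 0 ∧ (d * α * x + β) / (d * (γ * x + δ)) ∈ intermediateLevel d := by
  obtain ⟨r, s, rfl, hrs, h1, hd⟩ := hx
  have hs : (s : ℚ) ≠ 0 := by exact_mod_cast ne_zero_of_gcd_ne hd
  have hg0 : Int.gcd s d ≠ 0 := by simp [Int.gcd_eq_zero_iff, hd0]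
  obtain ⟨s', d', hcop, hs', hd'⟩ := Int.exists_gcd_one (Nat.pos_of_ne_zero hg0)
  set g := Int.gcd s d with hg
  have hcop : IsCoprime s' d' := Int.isCoprime_iff_gcd_eq_one.2 hcop
  have hgd : (g : ℤ) ∣ d := Int.gcd_dvd_right _ _
  have hgs : (g : ℤ) ∣ s := Int.gcd_dvd_left _ _
  have hd'0 : d' ≠ 0 := by
    rintro rfl
    simp [hd0] at hd'
  have hcopg : IsCoprime (γ * r + δ * s) g := by
    refine isCoprime_of_prime_dvd (fun h => hg0 (by exact_mod_cast h.2)) fun p hp hpl hpg => ?_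
    have hpd := hpg.trans hgd
    have hps := hpg.trans hgs
    rw [dvd_add_left (hps.mul_left _)] at hpl
    exact hrs p hp hpd ((hp.dvd_or_dvd hpl).resolve_left (hp.not_dvd_of_isCoprime hγ hpd)) hps
  have hgcd : Int.gcd (d' * (γ * r + δ * s)) d = d'.natAbs := by
    rw [hd', Int.gcd_mul_left, Int.isCoprime_iff_gcd_eq_one.1 hcopg, mul_one]
  have hdabs : d = d'.natAbs * g := by
    simpa [Int.natAbs_mul] using congrArg Int.natAbs hd'
  have hne_one : Int.gcd (d' * (γ * r + δ * s)) d ≠ 1 := by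
    rw [hgcd]
    intro h
    rw [h, one_mul] at hdabs
    exact hd hdabs.symm
  have hne : Int.gcd (d' * (γ * r + δ * s)) d ≠ d := by
    rw [hgcd]
    intro h
    rw [h] at hdabs
    exact h1 (Nat.eq_of_mul_eq_mul_left (Nat.pos_of_ne_zero hd0) (by omega))
  have hl : ((γ * r + δ * s : ℤ) : ℚ) ≠ 0 := by
    exact_mod_cast right_ne_zero_of_mul (ne_zero_of_gcd_ne hne)
  have hden : γ * ((r : ℚ) / s) + δ = (γ * r + δ * s : ℤ) / s := by
    push_cast
    field_simp
  refine ⟨hden ▸ div_ne_zero hl hs, d' * α * r + β * s', d' * (γ * r + δ * s), ?_, ?_,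
    hne_one, hne⟩
  · have hsq : (s : ℚ) = s' * g := by exact_mod_cast hs'
    have hdq : (d : ℚ) = d' * g := by exact_mod_cast hd'
    have hgq : (g : ℚ) ≠ 0 := by exact_mod_cast hg0
    have hd'q : (d' : ℚ) ≠ 0 := by exact_mod_cast hd'0
    have hdq0 : (d : ℚ) ≠ 0 := by exact_mod_cast hd0
    rw [hden]
    push_cast at hl ⊢
    rw [div_eq_div_iff (mul_ne_zero hdq0 (div_ne_zero hl hs)) (mul_ne_zero hd'q hl)]
    field_simp
    rw [hdq]
    linear_combination (β : ℚ) * d' * (γ * r + δ * s) * hsq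
  · intro p hp hpd hr hpt
    by_cases hpd' : p ∣ d'
    · rw [mul_assoc, dvd_add_right (hpd'.mul_right _)] at hr
      have hps' := (hp.dvd_or_dvd hr).resolve_left (hp.not_dvd_of_isCoprime hβ hpd)
      exact hp.not_dvd_of_isCoprime hcop hpd' hps'
    · have hpg : p ∣ g := (hp.dvd_or_dvd (hd' ▸ hpd)).resolve_left hpd'
      exact hp.not_dvd_of_isCoprime hcopg hpg ((hp.dvd_or_dvd hpt).resolve_left hpd')

lemma zero_notMem_intermediateLevel (d : ℕ) : (0 : ℚ) ∉ intermediateLevel d := by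
  rintro ⟨r, s, hx, hrs, h1, hd⟩
  have hs : (s : ℚ) ≠ 0 := by exact_mod_cast ne_zero_of_gcd_ne hd
  have hr : r = 0 := by simpa [hs] using hx.symm
  refine h1 (Int.isCoprime_iff_gcd_eq_one.1
    (isCoprime_of_prime_dvd (fun h => hs (by exact_mod_cast h.1)) fun p hp hps hpd => ?_))
  exact hrs p hp hpd (hr ▸ dvd_zero p) hps

lemma neg_one_notMem_intermediateLevel (d : ℕ) : (-1 : ℚ) ∉ intermediateLevel d := by
  rintro ⟨r, s, hx, hrs, h1, hd⟩
  have hs : (s : ℚ) ≠ 0 := by exact_mod_cast ne_zero_of_gcd_ne hd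
  have hr : r = -s := by
    rw [eq_div_iff hs] at hx
    exact_mod_cast (by linarith : (r : ℚ) = -s)
  refine h1 (Int.isCoprime_iff_gcd_eq_one.1
    (isCoprime_of_prime_dvd (fun h => hs (by exact_mod_cast h.1)) fun p hp hps hpd => ?_))
  exact hrs p hp hpd (hr ▸ hps.neg_right) hps

lemma notMem_intermediateLevel_den (u : ℚ) : u ∉ intermediateLevel u.den := by
  rintro ⟨r, s, hx, -, -, hd⟩
  have hs : (s : ℚ) ≠ 0 := by exact_mod_cast ne_zero_of_gcd_ne hd
  have hdvd : (u.den : ℤ) ∣ s := by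
    rw [hx, Rat.intCast_div_eq_divInt]
    exact Rat.den_dvd r s
  exact hd (by simpa using Int.gcd_eq_natAbs_right_iff_dvd.2 hdvd)

lemma inv_prime_mem_intermediateLevel {d p : ℕ} (hp : p.Prime) (hpd : p ∣ d) (hne : p ≠ d) :
    (p : ℚ)⁻¹ ∈ intermediateLevel d := by
  have hg : Int.gcd (p : ℤ) d = p := by
    rw [Int.gcd_natCast_natCast, Nat.gcd_eq_left hpd]
  refine ⟨1, p, by simp, fun q hq _ hq1 => absurd (isUnit_of_dvd_one hq1) hq.not_isUnit, ?_, ?_⟩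
  · rw [hg]; exact hp.one_lt.ne'
  · rwa [hg]

section PingPong

variable {α X : Type*} [MulAction (FreeGroup α) X] {S : Set X} {J : α × Bool → Set X}

/-- A nonempty reduced word maps a point outside the domain paired with the inverse of its last
letter into the domain of its first letter. -/
lemma FreeGroup.mk_smul_mem_of_isReduced
    (hS : ∀ g : FreeGroup α, ∀ x ∈ S, g • x ∈ S)
    (hJ : ∀ a, ∀ x ∈ S, x ∉ J (a.1, !a.2) → FreeGroup.mk [a] • x ∈ J a)
    (hdisj : ∀ a b, a ≠ b → Disjoint (J a) (J b))
    {x : X} (hx : x ∈ S) (l : List (α × Bool)) (a : α × Bool) (hl : FreeGroup.IsReduced (a :: l))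
    (hlast : x ∉ J (((a :: l).getLast (by simp)).1, !((a :: l).getLast (by simp)).2)) :
    FreeGroup.mk (a :: l) • x ∈ J a := by
  induction l generalizing a with
  | nil => exact hJ a x hx (by simpa using hlast)
  | cons b l ih =>
    have hl' := FreeGroup.isReduced_cons_cons.1 hl
    have hb := ih b hl'.2 (by simpa using hlast)
    have hsplit : FreeGroup.mk (a :: b :: l) = FreeGroup.mk [a] * FreeGroup.mk (b :: l) := by
      simp [FreeGroup.mul_mk]
    rw [hsplit, mul_smul]
    refine hJ a _ (hS _ _ hx) (Set.disjoint_left.1 (hdisj b _ ?_) hb)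
    rintro rfl
    simpa using hl'.1

/-- In a ping-pong configuration, a fixed point in `S` of a nontrivial element lies, up to
conjugation, in a domain whose complement is mapped to itself by the element or its inverse. -/
lemma FreeGroup.exists_conj_mapsTo_of_smul_eq_self
    (hS : ∀ g : FreeGroup α, ∀ x ∈ S, g • x ∈ S)
    (hJ : ∀ a, ∀ x ∈ S, x ∉ J (a.1, !a.2) → FreeGroup.mk [a] • x ∈ J a)
    (hdisj : ∀ a b, a ≠ b → Disjoint (J a) (J b))
    {g : FreeGroup α} (hg : g ≠ 1) {x : X} (hx : x ∈ S) (hgx : g • x = x) :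
    ∃ h : FreeGroup α, ∃ a, h • x ∈ J a ∧
      (Set.MapsTo ((h * g * h⁻¹) • ·) (S \ J a) (S \ J a) ∨
        Set.MapsTo ((h * g⁻¹ * h⁻¹) • ·) (S \ J a) (S \ J a)) := by
  obtain ⟨l, hl, rfl⟩ : ∃ l, FreeGroup.IsReduced l ∧ FreeGroup.mk l = g := by
    classical exact ⟨g.toWord, FreeGroup.isReduced_toWord, FreeGroup.mk_toWord⟩
  induction hn : l.length using Nat.strong_induction_on generalizing l x with
  | _ n ih =>
  obtain _ | ⟨a, l⟩ := l
  · exact absurd rfl hg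
  set e := (a :: l).getLast (by simp) with he
  by_cases hae : (e.1, !e.2) = a
  · obtain rfl | ⟨m, b, rfl⟩ := l.eq_nil_or_concat
    · have : (e.1, !e.2) = e := hae.trans (by simp [he])
      simp [Prod.ext_iff] at this
    · have heb : e = b := by simp [he]
      have hb : b = (a.1, !a.2) := by simp [← hae, heb]
      have hmk : FreeGroup.mk (a :: (m ++ [b])) =
          FreeGroup.mk [a] * FreeGroup.mk m * (FreeGroup.mk [a])⁻¹ := by
        simp [FreeGroup.mul_mk, FreeGroup.inv_mk, FreeGroup.invRev, hb]
      simp only [List.concat_eq_append] at hl hgx hg hn ⊢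
      rw [hmk] at hgx hg ⊢
      obtain ⟨h, c, hc, hmaps⟩ := ih m.length (by simp at hn; omega)
        (x := (FreeGroup.mk [a])⁻¹ • x) (hS _ _ hx) m
        (hl.infix ⟨[a], [b], by simp⟩) (fun h1 => hg (by rw [h1]; group))
        (by
          rw [mul_smul, mul_smul] at hgx
          exact eq_inv_smul_iff.2 hgx) rfl
      refine ⟨h * (FreeGroup.mk [a])⁻¹, c, by rwa [mul_smul], ?_⟩
      generalize FreeGroup.mk [a] = q
      generalize FreeGroup.mk m = w at hmaps ⊢
      rwa [show h * q⁻¹ * (q * w * q⁻¹) * (h * q⁻¹)⁻¹ = h * w * h⁻¹ by group,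
        show h * q⁻¹ * (q * w * q⁻¹)⁻¹ * (h * q⁻¹)⁻¹ = h * w⁻¹ * h⁻¹ by group]
  · have hfwd : ∀ y ∈ S, y ∉ J (e.1, !e.2) → FreeGroup.mk (a :: l) • y ∈ J a := fun y hy hye =>
      FreeGroup.mk_smul_mem_of_isReduced hS hJ hdisj hy l a hl hye
    have hdis := hdisj _ _ hae
    by_cases hxe : x ∈ J (e.1, !e.2)
    · refine ⟨1, (e.1, !e.2), by simpa using hxe, Or.inl fun y hy => ?_⟩
      simp only [one_mul, inv_one, mul_one]
      exact ⟨hS _ _ hy.1, Set.disjoint_right.1 hdis (hfwd y hy.1 hy.2)⟩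
    · refine ⟨1, a, by simpa [hgx] using hfwd x hx hxe, Or.inr fun y hy => ?_⟩
      simp only [one_mul, inv_one, mul_one]
      refine ⟨hS _ _ hy.1, fun hya => ?_⟩
      have := hfwd _ (hS _ _ hy.1) (Set.disjoint_right.1 hdis hya)
      rw [smul_inv_smul] at this
      exact hy.2 this

end PingPong

section Parabolic

/-- A parabolic element fixing `y` becomes a translation in the coordinate `(z - y)⁻¹`. -/
lemma Matrix.GeneralLinearGroup.IsParabolic.exists_inv_sub_eq {K : Type*} [Field K]
    [DecidableEq K] {B : GL (Fin 2) K} (hB : B.IsParabolic) {y : K}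
    (hy : B • (y : OnePoint K) = y) :
    ∃ κ : K, κ ≠ 0 ∧ ∀ z w : K, z ≠ y → B • (z : OnePoint K) = w →
      (w - y)⁻¹ = (z - y)⁻¹ + κ := by
  obtain ⟨hns, hdisc⟩ := hB
  rw [Matrix.discr_fin_two, Matrix.trace_fin_two, Matrix.det_fin_two] at hdisc
  rw [OnePoint.smul_some_eq_ite] at hy
  split_ifs at hy with hl
  · exact absurd hy (OnePoint.infty_ne_coe _)
  replace hy := OnePoint.coe_injective hy
  rw [div_eq_iff hl] at hy
  have ha : B 0 0 - B 1 0 * y = B 1 0 * y + B 1 1 := by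
    have : (B 0 0 - B 1 0 * y - (B 1 0 * y + B 1 1)) ^ 2 = 0 := by
      linear_combination hdisc - 4 * B 1 0 * hy
    exact sub_eq_zero.1 (pow_eq_zero_iff two_ne_zero |>.1 this)
  refine ⟨B 1 0 / (B 1 0 * y + B 1 1), div_ne_zero (fun hc => hns ?_) hl, fun z w hz hw => ?_⟩
  · have h00 : B 0 0 = B 1 1 := by linear_combination ha + 2 * y * hc
    have h01 : B 0 1 = 0 := by linear_combination hy - y * ha - y ^ 2 * hc
    refine ⟨B 1 1, ?_⟩
    ext i j
    fin_cases i <;> fin_cases j <;> simp [h00, h01, hc]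
  · rw [OnePoint.smul_some_eq_ite] at hw
    split_ifs at hw with hm
    · exact absurd hw (OnePoint.infty_ne_coe _)
    replace hw := OnePoint.coe_injective hw
    have hzy : z - y ≠ 0 := sub_ne_zero.2 hz
    have hwy : w - y = (B 1 0 * y + B 1 1) * (z - y) / (B 1 0 * z + B 1 1) := by
      rw [← hw, eq_div_iff hm, sub_mul, div_mul_cancel₀ _ hm]
      linear_combination hy + (z - y) * ha
    rw [hwy, inv_div]
    field_simp
    ring

/-- A translation by a nonzero amount in the coordinate `(z - y)⁻¹` preserves no nonempty set of
finite points bounded away from `y`. -/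
lemma not_mapsTo_of_inv_sub_eq {f : OnePoint ℚ → OnePoint ℚ} {y κ ε : ℚ} (hκ : κ ≠ 0)
    (hε : 0 < ε)
    (hf : ∀ z w : ℚ, z ≠ y → f z = w → (w - y)⁻¹ = (z - y)⁻¹ + κ)
    {K : Set (OnePoint ℚ)} (hne : K.Nonempty) (hK : K ⊆ (↑) '' {z : ℚ | ε ≤ |z - y|}) :
    ¬ Set.MapsTo f K K := by
  intro hmaps
  obtain ⟨k, hk⟩ := hne
  obtain ⟨z₀, -, rfl⟩ := hK hk
  have hiter : ∀ n : ℕ, ∃ z : ℚ, (z : OnePoint ℚ) ∈ K ∧ (z - y)⁻¹ = (z₀ - y)⁻¹ + n * κ := by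
    intro n
    induction n with
    | zero => exact ⟨z₀, hk, by simp⟩
    | succ n ih =>
      obtain ⟨z, hz, hzn⟩ := ih
      obtain ⟨w, -, hw⟩ := hK (hmaps hz)
      obtain ⟨z', hz', hzz'⟩ := hK hz
      obtain rfl := OnePoint.coe_injective hzz'
      have hzy : z' ≠ y := by
        rintro rfl
        simp at hz'
        linarith
      refine ⟨w, hw ▸ hmaps hz, ?_⟩
      rw [hf z' w hzy hw.symm, hzn]
      push_cast
      ring
  obtain ⟨n, hn⟩ := exists_nat_gt ((ε⁻¹ + |(z₀ - y)⁻¹|) / |κ|)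
  rw [div_lt_iff₀ (abs_pos.2 hκ)] at hn
  obtain ⟨z, hz, hzn⟩ := hiter n
  obtain ⟨z', hz', hzz'⟩ := hK hz
  obtain rfl := OnePoint.coe_injective hzz'
  have hbound : |(z' - y)⁻¹| ≤ ε⁻¹ := by
    rw [abs_inv]
    exact inv_anti₀ hε hz'
  have hnκ : (n : ℚ) * |κ| = |(z' - y)⁻¹ - (z₀ - y)⁻¹| := by
    rw [hzn, add_sub_cancel_left, abs_mul, Nat.abs_cast]
  have := abs_sub (z' - y)⁻¹ (z₀ - y)⁻¹
  linarith

lemma Matrix.GeneralLinearGroup.inv_smul_coe {K : Type*} [Field K] [DecidableEq K]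
    (A : GL (Fin 2) K) {x : K} (hx : A 0 0 - A 1 0 * x ≠ 0) :
    A⁻¹ • (x : OnePoint K) = ((A 1 1 * x - A 0 1) / (A 0 0 - A 1 0 * x) : K) := by
  have hdet : A 0 0 * A 1 1 - A 0 1 * A 1 0 ≠ 0 := by
    rw [← Matrix.det_fin_two]
    exact A.det_ne_zero
  have hden : A 1 0 * ((A 1 1 * x - A 0 1) / (A 0 0 - A 1 0 * x)) + A 1 1 =
      (A 0 0 * A 1 1 - A 0 1 * A 1 0) / (A 0 0 - A 1 0 * x) := by
    field_simp
    ring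
  rw [inv_smul_eq_iff, OnePoint.smul_some_eq_ite, hden, if_neg (div_ne_zero hdet hx)]
  rw [OnePoint.coe_eq_coe, eq_div_iff (div_ne_zero hdet hx),
    mul_div_assoc', mul_div_assoc', div_add' _ _ _ hx, div_left_inj' hx]
  ring

end Parabolic

section Delta

/-- The interiors of the four intervals cut out by the cusps `∞, -1, 0, u²`, indexed by the
generators of `Δ(u²,2t)` and their inverses. -/
def pingPongInterval (u : ℚ) : Bool × Bool → Set ℚ
  | (false, true) => Set.Ioi u
  | (false, false) => Set.Ioo (-1) 0
  | (true, true) => Set.Ioo 0 u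
  | (true, false) => Set.Iio (-1)

variable {t : ℤ} {u : ℚ} {f : Bool → GL (Fin 2) ℚ}

lemma isOpen_pingPongInterval (u : ℚ) (a : Bool × Bool) : IsOpen (pingPongInterval u a) := by
  rcases a with ⟨_ | _, _ | _⟩
  exacts [isOpen_Ioo, isOpen_Ioi, isOpen_Iio, isOpen_Ioo]

lemma disjoint_pingPongInterval (hu : 0 < u) {a b : Bool × Bool} (hab : a ≠ b) :
    Disjoint (pingPongInterval u a) (pingPongInterval u b) := by
  rw [Set.disjoint_left]
  rcases a with ⟨_ | _, _ | _⟩ <;> rcases b with ⟨_ | _, _ | _⟩ <;>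
    simp only [pingPongInterval, Set.mem_Ioi, Set.mem_Iio, Set.mem_Ioo, ne_eq,
      not_true_eq_false] at hab ⊢ <;>
    intros <;> grind

lemma exists_letter_smul_eq (hu : 0 < u) (ht : u < t - 1)
    (hf₁ : (f false).val = !![(t : ℚ) - 1, u; 1, 1])
    (hf₂ : (f true).val = !![u, u; 1, (t : ℚ) - u])
    (a : Bool × Bool) {x : ℚ} (hx : x ∈ intermediateLevel u.den) :
    ∃ y ∈ intermediateLevel u.den,
      FreeGroup.lift f (FreeGroup.mk [a]) • (x : OnePoint ℚ) = y ∧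
      (x ∉ pingPongInterval u (a.1, !a.2) → y ∈ pingPongInterval u a) := by
  have hd : (u.den : ℚ) ≠ 0 := by exact_mod_cast u.den_ne_zero
  have hnum : (u.num : ℚ) = u * u.den := (Rat.mul_den_eq_num u).symm
  have hx0 : x ≠ 0 := fun h => zero_notMem_intermediateLevel _ (h ▸ hx)
  have hx1 : x ≠ -1 := fun h => neg_one_notMem_intermediateLevel _ (h ▸ hx)
  have hxu : x ≠ u := fun h => notMem_intermediateLevel_den u (h ▸ hx)
  have hcop : IsCoprime u.num u.den := by
    rw [Int.isCoprime_iff_gcd_eq_one]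
    exact u.reduced
  have hcop' : IsCoprime (u.den * t - u.num) u.den := by
    rw [sub_eq_add_neg, add_comm]
    exact hcop.neg_left.add_mul_left_left _
  rcases a with ⟨_ | _, _ | _⟩
  · obtain ⟨hne, hmem⟩ := intermediateLevel_atkinLehner u.den_ne_zero (α := 1) (β := -u.num)
      (γ := -1) (δ := t - 1) hcop.neg_left isCoprime_one_left.neg_left hx
    have hne' : (t : ℚ) - 1 - x ≠ 0 := by
      intro h
      apply hne
      push_cast
      linarith
    have hval : (((u.den : ℚ) * (1 : ℤ) * x + (-u.num : ℤ)) /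
        (u.den * ((-1 : ℤ) * x + (t - 1 : ℤ)))) = (x - u) / (t - 1 - x) := by
      rw [div_eq_div_iff (mul_ne_zero hd hne) hne']
      push_cast
      rw [hnum]
      ring
    refine ⟨_, hval ▸ hmem, ?_, fun h => ?_⟩
    · have := (f false).inv_smul_coe (x := x) (by simpa [hf₁] using hne')
      simpa [hf₁] using this
    · have hlt : x < u := lt_of_le_of_ne (by simpa [pingPongInterval] using h) hxu
      have hpos : (0 : ℚ) < t - 1 - x := by linarith
      constructor
      · rw [lt_div_iff₀ hpos]
        linarith
      · exact div_neg_of_neg_of_pos (by linarith) hpos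
  · obtain ⟨hne, hmem⟩ := intermediateLevel_atkinLehner u.den_ne_zero (α := t - 1) (β := u.num)
      (γ := 1) (δ := 1) hcop isCoprime_one_left hx
    have hne' : x + 1 ≠ 0 := by simpa using hne
    have hval : (((u.den : ℚ) * (t - 1 : ℤ) * x + u.num) /
        (u.den * ((1 : ℤ) * x + (1 : ℤ)))) = ((t - 1) * x + u) / (x + 1) := by
      rw [div_eq_div_iff (mul_ne_zero hd hne) hne']
      push_cast
      rw [hnum]
      ring
    refine ⟨_, hval ▸ hmem, ?_, fun h => ?_⟩
    · simp [OnePoint.smul_some_eq_ite, hf₁, hne']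
    · have hsub : ((t - 1) * x + u) / (x + 1) - u = (t - 1 - u) * x / (x + 1) := by
        field_simp
        ring
      have hx' : x < -1 ∨ 0 < x := by
        simp only [pingPongInterval, Set.mem_Ioo, Bool.not_true, not_and_or, not_lt] at h
        exact h.imp (lt_of_le_of_ne · hx1) (lt_of_le_of_ne · hx0.symm)
      rw [pingPongInterval, Set.mem_Ioi]
      rw [← sub_pos, hsub]
      rcases hx' with hx' | hx'
      · exact div_pos_of_neg_of_neg (mul_neg_of_pos_of_neg (by linarith) (by linarith))
          (by linarith)
      · exact div_pos (mul_pos (by linarith) hx') (by linarith)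
  · obtain ⟨hne, hmem⟩ := intermediateLevel_gammaZero (d := u.den) (α := u.den * t - u.num)
      (β := -u.num) (γ := -1) (δ := u.num) hcop' hcop hx
    have hne' : u - x ≠ 0 := sub_ne_zero.2 hxu.symm
    have hval : (((u.den * t - u.num : ℤ) : ℚ) * x + (-u.num : ℤ)) /
        (u.den * (-1 : ℤ) * x + u.num) = ((t - u) * x - u) / (u - x) := by
      rw [div_eq_div_iff hne hne']
      push_cast
      rw [hnum]
      ring
    refine ⟨_, hval ▸ hmem, ?_, fun h => ?_⟩
    · have := (f true).inv_smul_coe (x := x) (by simpa [hf₂] using hne')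
      simpa [hf₂] using this
    · have hsub : ((t - u) * x - u) / (u - x) + 1 = (t - 1 - u) * x / (u - x) := by
        field_simp
        ring
      have hx' : x < 0 ∨ u < x := by
        simp only [pingPongInterval, Set.mem_Ioo, Bool.not_false, not_and_or, not_lt] at h
        exact h.imp (lt_of_le_of_ne · hx0) (lt_of_le_of_ne · hxu.symm)
      rw [pingPongInterval, Set.mem_Iio]
      rw [← sub_neg, sub_neg_eq_add, hsub]
      rcases hx' with hx' | hx'
      · exact div_neg_of_neg_of_pos (mul_neg_of_pos_of_neg (by linarith) hx') (by linarith)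
      · exact div_neg_of_pos_of_neg (mul_pos (by linarith) (by linarith)) (by linarith)
  · obtain ⟨hne, hmem⟩ := intermediateLevel_gammaZero (d := u.den) (α := u.num)
      (β := u.num) (γ := 1) (δ := u.den * t - u.num) hcop hcop' hx
    have hfac : (u.den : ℚ) * (1 : ℤ) * x + (u.den * t - u.num : ℤ) = u.den * (x + (t - u)) := by
      push_cast
      rw [hnum]
      ring
    have hne' : x + (t - u) ≠ 0 := right_ne_zero_of_mul (hfac ▸ hne)
    have hval : ((u.num : ℚ) * x + u.num) /
        (u.den * (1 : ℤ) * x + (u.den * t - u.num : ℤ)) = (u * x + u) / (x + (t - u)) := by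
      rw [hfac, div_eq_div_iff (mul_ne_zero hd hne') hne', hnum]
      ring
    refine ⟨_, hval ▸ hmem, ?_, fun h => ?_⟩
    · simp [OnePoint.smul_some_eq_ite, hf₂, hne']
    · have hlt : -1 < x := lt_of_le_of_ne (by simpa [pingPongInterval] using h) hx1.symm
      have hpos : (0 : ℚ) < x + (t - u) := by linarith
      constructor
      · exact div_pos (by nlinarith) hpos
      · rw [div_lt_iff₀ hpos]
        nlinarith

/-- No parabolic element of the group generated by `M₁` and `M₂` fixes a point of intermediate
level. -/
lemma not_isParabolic_of_smul_eq_self (hu : 0 < u) (ht : u < t - 1)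
    (hf₁ : (f false).val = !![(t : ℚ) - 1, u; 1, 1])
    (hf₂ : (f true).val = !![u, u; 1, (t : ℚ) - u])
    (g : FreeGroup Bool) {x : ℚ} (hx : x ∈ intermediateLevel u.den)
    (hgx : FreeGroup.lift f g • (x : OnePoint ℚ) = x) : ¬ (FreeGroup.lift f g).IsParabolic := by
  intro hpar
  let _ : MulAction (FreeGroup Bool) (OnePoint ℚ) := MulAction.compHom _ (FreeGroup.lift f)
  have hsmul : ∀ (h : FreeGroup Bool) (z : OnePoint ℚ), h • z = FreeGroup.lift f h • z :=
    fun _ _ => rfl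
  let S : Set (OnePoint ℚ) := (↑) '' intermediateLevel u.den
  let J : Bool × Bool → Set (OnePoint ℚ) := fun a => (↑) '' pingPongInterval u a
  have hletter : ∀ a : Bool × Bool, ∀ z ∈ S, FreeGroup.mk [a] • z ∈ S := by
    rintro a _ ⟨z, hz, rfl⟩
    obtain ⟨y, hy, hzy, -⟩ := exists_letter_smul_eq hu ht hf₁ hf₂ a hz
    exact ⟨y, hy, hzy.symm⟩
  have hS : ∀ h : FreeGroup Bool, ∀ z ∈ S, h • z ∈ S := by
    intro h
    induction h using FreeGroup.induction_on with
    | C1 => simp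
    | of i => exact hletter (i, true)
    | inv_of i _ => exact hletter (i, false)
    | mul h k hh hk => exact fun z hz => mul_smul h k z ▸ hh _ (hk z hz)
  have hJ : ∀ a : Bool × Bool, ∀ z ∈ S, z ∉ J (a.1, !a.2) → FreeGroup.mk [a] • z ∈ J a := by
    rintro a _ ⟨z, hz, rfl⟩ hza
    obtain ⟨y, -, hzy, hy⟩ := exists_letter_smul_eq hu ht hf₁ hf₂ a hz
    exact ⟨y, hy fun h => hza ⟨z, h, rfl⟩, hzy.symm⟩
  have hdisj : ∀ a b, a ≠ b → Disjoint (J a) (J b) := fun a b hab =>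
    Set.disjoint_image_of_injective OnePoint.coe_injective (disjoint_pingPongInterval hu hab)
  have hg : g ≠ 1 := by
    rintro rfl
    exact hpar.1 ⟨1, by simp⟩
  obtain ⟨h, a, hxa, hmaps⟩ :=
    FreeGroup.exists_conj_mapsTo_of_smul_eq_self hS hJ hdisj hg ⟨x, hx, rfl⟩ hgx
  have hhx := hS h x ⟨x, hx, rfl⟩
  obtain ⟨y, hy, hxy⟩ := hxa
  have hpar' : (FreeGroup.lift f (h * g * h⁻¹)).IsParabolic := by
    simpa only [map_mul, map_inv, Matrix.GeneralLinearGroup.isParabolic_conj_iff] using hpar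
  have hfix : (h * g * h⁻¹) • (y : OnePoint ℚ) = y := by
    rw [hxy, mul_smul, mul_smul, inv_smul_smul]
    exact congrArg (h • ·) hgx
  obtain ⟨κ, hκ, htrans⟩ := hpar'.exists_inv_sub_eq hfix
  obtain ⟨ε, hε, hball⟩ := Metric.isOpen_iff.1 (isOpen_pingPongInterval u a) y hy
  obtain ⟨δ, hδ, hδε⟩ := exists_rat_btwn hε
  have hfar : S \ J a ⊆ (↑) '' {z : ℚ | δ ≤ |z - y|} := by
    rintro _ ⟨⟨z, -, rfl⟩, hza⟩
    refine ⟨z, ?_, rfl⟩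
    by_contra hlt
    rw [Set.mem_ofPred_eq, not_le] at hlt
    refine hza ⟨z, hball ?_, rfl⟩
    rw [Metric.mem_ball, Rat.dist_eq]
    exact lt_trans (by exact_mod_cast hlt) hδε
  have hnonempty : (S \ J a).Nonempty := by
    have hmem : (y : OnePoint ℚ) ∈ J a := ⟨y, hy, rfl⟩
    have hmove := hJ (!a.1, true) (h • x) hhx
      (Set.disjoint_left.1 (hdisj a _ (by simp [Prod.ext_iff])) (hxy ▸ hmem))
    exact ⟨_, hS _ _ hhx, Set.disjoint_right.1 (hdisj a _ (by simp [Prod.ext_iff])) hmove⟩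
  have hδ0 : 0 < δ := by exact_mod_cast hδ
  rcases hmaps with hmaps | hmaps
  · exact not_mapsTo_of_inv_sub_eq hκ hδ0 htrans hnonempty hfar hmaps
  · refine not_mapsTo_of_inv_sub_eq (neg_ne_zero.2 hκ) hδ0 (fun z w hz hw => ?_) hnonempty hfar
      hmaps
    have hzw : (h * g * h⁻¹) • (w : OnePoint ℚ) = z := by
      rw [← hw, show h * g⁻¹ * h⁻¹ = (h * g * h⁻¹)⁻¹ by group]
      exact smul_inv_smul _ _
    have hwy : w ≠ y := by
      rintro rfl
      exact hz (OnePoint.coe_injective (hzw.symm.trans hfix))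
    rw [htrans w z hwy hzw]
    ring

lemma moebius_eq_smul (A : GL (Fin 2) ℚ) (x : ℚ) : moebius A x = A • (x : OnePoint ℚ) := by
  rw [OnePoint.smul_some_eq_ite]
  rfl

lemma Delta_eq_map_range (hf₁ : (f false).val = !![(t : ℚ) - 1, u; 1, 1])
    (hf₂ : (f true).val = !![u, u; 1, (t : ℚ) - u]) :
    Delta u t = (FreeGroup.lift f).range.map pgl := by
  rw [Delta, FreeGroup.range_lift_eq_closure, MonoidHom.map_closure]
  congr 2
  ext A
  rw [Set.mem_ofPred_eq, ← hf₁, ← hf₂, Units.val_inj, Units.val_inj, Set.mem_range,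
    Bool.exists_bool, eq_comm, @eq_comm _ A]

/-- Points of intermediate level are not cusps of `Δ(u²,2t)`. -/
lemma notMem_finiteCusps_Delta (hu : 0 < u) (ht : u < t - 1) {x : ℚ}
    (hx : x ∈ intermediateLevel u.den) : x ∉ finiteCusps (Delta u t) := by
  rintro ⟨A, hA, hA1, htr, hfix⟩
  let f : Bool → GL (Fin 2) ℚ := fun i => bif i
    then Matrix.GeneralLinearGroup.mkOfDetNeZero !![u, u; 1, (t : ℚ) - u] (by
      rw [Matrix.det_fin_two_of, show u * (t - u) - u * 1 = u * (t - 1 - u) by ring]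
      exact mul_ne_zero hu.ne' (by linarith))
    else Matrix.GeneralLinearGroup.mkOfDetNeZero !![(t : ℚ) - 1, u; 1, 1] (by
      rw [Matrix.det_fin_two_of]
      intro h
      linarith)
  have hf₁ : (f false).val = !![(t : ℚ) - 1, u; 1, 1] := rfl
  have hf₂ : (f true).val = !![u, u; 1, (t : ℚ) - u] := rfl
  rw [Delta_eq_map_range hf₁ hf₂] at hA
  obtain ⟨_, ⟨g, rfl⟩, hgA⟩ := hA
  obtain ⟨z, hz, hAz⟩ := (QuotientGroup.mk'_eq_mk' _).1 hgA.symm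
  obtain ⟨c, hc⟩ := Matrix.GeneralLinearGroup.mem_center_iff_val_mem_range_scalar.1 hz
  have hc0 : c ≠ 0 := by
    rintro rfl
    exact z.det_ne_zero (by simp [← hc])
  have hval : (FreeGroup.lift f g).val = c • A.val := by
    rw [← hAz, Units.val_mul, ← hc, Matrix.scalar_apply, ← Matrix.smul_eq_mul_diagonal]
  refine not_isParabolic_of_smul_eq_self hu ht hf₁ hf₂ g hx ?_ ⟨fun hscalar => hA1 ?_, ?_⟩
  · have hzx : z • (x : OnePoint ℚ) = x := by
      simp [OnePoint.smul_some_eq_ite, ← hc, hc0]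
    rw [← hAz, mul_smul, hzx, ← moebius_eq_smul, hfix]
  · rw [← hgA]
    exact (QuotientGroup.eq_one_iff _).2
      (Matrix.GeneralLinearGroup.mem_center_iff_val_mem_range_scalar.2 hscalar)
  · rw [hval, Matrix.discr_fin_two, Matrix.trace_smul, Matrix.det_smul, Fintype.card_fin,
      smul_eq_mul]
    linear_combination c ^ 2 * htr

end Delta

/-- **Proposition 5(a).** Let `t` be an integer and `0 < u² < t − 1`. If the
finite cusp set of `Δ(u²,2t)` is all of `ℚ` (in particular if `Δ(u²,2t)` is pseudomodular),
then the denominator of `u²` is `1` or a prime. -/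
theorem denom_unit_or_prime_of_cusps_eq_univ (t : ℤ) (u2 : ℚ)
    (h0 : 0 < u2) (h1 : u2 < (t : ℚ) - 1)
    (hcusps : finiteCusps (Delta u2 (t : ℚ)) = Set.univ) :
    u2.den = 1 ∨ Nat.Prime u2.den := by
  by_contra! h
  have hp := Nat.minFac_prime h.1
  refine notMem_finiteCusps_Delta h0 h1
    (inv_prime_mem_intermediateLevel hp (Nat.minFac_dvd _) fun heq => h.2 (heq ▸ hp)) ?_
  simp [hcusps]
end

section
/- Let p be a prime and t an integer with t ≥ 2, and set u² = 1/p² (note 0 < 1/p² < t − 1). Then the image of the finite cusp set C(Δ(1/p², 2t)) under the canonical embedding ℚ → ℚ_p is not dense in ℚ_p; in particular C(Δ(1/p², 2t)) ≠ ℚ, so Δ(1/p², 2t) is neither pseudomodular nor arithmetic. -/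
open Matrix

/-- A non-scalar matrix with `tr² = 4 det` fixing a point outside the interval
with endpoints `e`, `f` cannot map the complement of that interval into itself. -/
lemma parabolic_not_contracting {B : Matrix (Fin 2) (Fin 2) ℚ} {v e f : Fin 2 → ℚ} {μ : ℚ}
    {q : (Fin 2 → ℚ) → ℚ}
    (hq : ∀ w, q w = (e 0 * w 1 - e 1 * w 0) * (w 0 * f 1 - w 1 * f 0))
    (htr : B.trace ^ 2 = 4 * B.det)
    (hns : ¬ (B 0 0 = B 1 1 ∧ B 0 1 = 0 ∧ B 1 0 = 0))
    (hv : v 1 ≠ 0) (hfix : B *ᵥ v = μ • v) (hneg : q v < 0)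
    (hmap : ∀ w, q w < 0 → q (B *ᵥ w) < 0) : False := by
  obtain ⟨l, hl⟩ : ∃ l, l = B.trace / 2 := ⟨_, rfl⟩
  rw [trace_fin_two] at hl
  rw [trace_fin_two, det_fin_two] at htr
  have h0 : B 0 0 * v 0 + B 0 1 * v 1 = μ * v 0 := by
    simpa [mulVec, dotProduct, Fin.sum_univ_two] using congrFun hfix 0
  have h1 : B 1 0 * v 0 + B 1 1 * v 1 = μ * v 1 := by
    simpa [mulVec, dotProduct, Fin.sum_univ_two] using congrFun hfix 1
  have hμ : μ = l := by
    have : (μ - l) ^ 2 * v 1 = 0 := by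
      have hμ2 : (μ ^ 2 - (B 0 0 + B 1 1) * μ + (B 0 0 * B 1 1 - B 0 1 * B 1 0)) * v 1 = 0 := by
        linear_combination (B 0 0 - μ) * h1 - B 1 0 * h0
      subst hl
      linear_combination hμ2 + v 1 / 4 * htr
    have := (mul_eq_zero.mp this).resolve_right hv
    exact sub_eq_zero.mp (pow_eq_zero_iff (two_ne_zero) |>.mp this)
  obtain ⟨k, hk⟩ : ∃ k, k = B 1 0 / v 1 ^ 2 := ⟨_, rfl⟩
  have hc : B 1 0 = k * v 1 ^ 2 := by rw [hk]; field_simp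
  have hd : B 1 1 = l - k * v 0 * v 1 := by
    apply mul_right_cancel₀ hv
    rw [hc, hμ] at h1
    linear_combination h1
  have ha : B 0 0 = l + k * v 0 * v 1 := by linear_combination -2 * hl - hd
  have hb : B 0 1 = -k * v 0 ^ 2 := by
    apply mul_right_cancel₀ hv
    rw [ha, hμ] at h0
    linear_combination h0
  have hk0 : k ≠ 0 := by
    rintro rfl
    exact hns (by simp [ha, hb, hc, hd])
  have key : ∀ w, q w = 0 → 0 ≤ q ![B 1 1 * w 0 - B 0 1 * w 1, -B 1 0 * w 0 + B 0 0 * w 1] := by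
    intro w hw
    by_contra! h
    have := hmap _ h
    rw [hq] at this hw
    simp [mulVec, dotProduct, Fin.sum_univ_two] at this
    refine absurd this (not_lt.mpr (le_of_eq ?_))
    linear_combination -(B 0 0 * B 1 1 - B 0 1 * B 1 0) ^ 2 * hw
  have k1 := key e (by rw [hq]; ring)
  have k2 := key f (by rw [hq]; ring)
  rw [hq] at k1 k2 hneg
  simp only [cons_val_zero, cons_val_one, ha, hb, hc, hd] at k1 k2
  set T := e 0 * v 1 - e 1 * v 0 with hT
  set S := v 0 * f 1 - v 1 * f 0 with hS
  have hT0 : T ≠ 0 := by rintro h; simp [h] at hneg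
  have hS0 : S ≠ 0 := by rintro h; simp [h] at hneg
  have p1 : 0 ≤ T ^ 2 * (-(l * k * (e 0 * f 1 - e 1 * f 0)) + k ^ 2 * (T * S)) := by
    refine k1.trans_eq ?_
    rw [hT, hS]; ring
  have p2 : 0 ≤ S ^ 2 * ((l * k * (e 0 * f 1 - e 1 * f 0)) + k ^ 2 * (T * S)) := by
    refine k2.trans_eq ?_
    rw [hT, hS]; ring
  have p1' := nonneg_of_mul_nonneg_right p1 (by positivity)
  have p2' := nonneg_of_mul_nonneg_right p2 (by positivity)
  have : k ^ 2 * (T * S) < 0 := mul_neg_of_pos_of_neg (by positivity) hneg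
  linarith

/-- The quadratic forms that are positive exactly on the intervals `(s, ∞)`, `(-1, 0)`, `(0, s)`,
`(-∞, -1)`, indexed by the letter of the free group whose image contracts into that interval. -/
def intervalForm (s : ℚ) : Bool × Bool → (Fin 2 → ℚ) → ℚ
  | (true, true), v => v 1 * (v 0 - s * v 1)
  | (true, false), v => -v 0 * (v 0 + v 1)
  | (false, true), v => v 0 * (s * v 1 - v 0)
  | (false, false), v => -v 1 * (v 0 + v 1)

lemma intervalForm_eq_endpoints (s : ℚ) (a : Bool × Bool) : ∃ e f : Fin 2 → ℚ, ∀ w,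
    intervalForm s a w = (e 0 * w 1 - e 1 * w 0) * (w 0 * f 1 - w 1 * f 0) := by
  match a with
  | (true, true) => exact ⟨![s, 1], ![1, 0], fun w => by simp [intervalForm]; ring⟩
  | (true, false) => exact ⟨![-1, 1], ![0, 1], fun w => by simp [intervalForm]; ring⟩
  | (false, true) => exact ⟨![0, 1], ![s, 1], fun w => by simp [intervalForm]; ring⟩
  | (false, false) => exact ⟨![-1, 0], ![-1, 1], fun w => by simp [intervalForm]⟩

lemma intervalForm_smul (s c : ℚ) (a : Bool × Bool) (w : Fin 2 → ℚ) :
    intervalForm s a (c • w) = c ^ 2 * intervalForm s a w := by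
  obtain ⟨e, f, h⟩ := intervalForm_eq_endpoints s a
  simp [h]; ring

lemma intervalForm_nonpos_of_nonneg {s : ℚ} (hs : 0 < s) {a b : Bool × Bool} (hab : a ≠ b)
    {w : Fin 2 → ℚ} (h : 0 ≤ intervalForm s a w) : intervalForm s b w ≤ 0 := by
  match a, b with
  | (true, true), (true, true) | (true, false), (true, false) | (false, true), (false, true)
  | (false, false), (false, false) => exact absurd rfl hab
  | (true, true), (true, false) | (true, true), (false, true) | (true, true), (false, false)
  | (true, false), (true, true) | (true, false), (false, true) | (true, false), (false, false)
  | (false, true), (true, true) | (false, true), (true, false) | (false, true), (false, false)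
  | (false, false), (true, true) | (false, false), (true, false) | (false, false), (false, true) =>
    simp only [intervalForm] at h ⊢
    nlinarith [sq_nonneg (w 0), sq_nonneg (w 1), sq_nonneg (w 0 + w 1), sq_nonneg (w 0 - s * w 1),
      mul_nonneg hs.le (sq_nonneg (w 0)), mul_nonneg hs.le (sq_nonneg (w 1)), mul_nonneg hs.le h]

lemma intervalForm_neg_of_pos {s : ℚ} (hs : 0 < s) {a b : Bool × Bool} (hab : a ≠ b)
    {w : Fin 2 → ℚ} (h : 0 < intervalForm s a w) : intervalForm s b w < 0 := by
  refine lt_of_le_of_ne (intervalForm_nonpos_of_nonneg hs hab h.le) fun h0 => ?_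
  exact absurd (intervalForm_nonpos_of_nonneg hs hab.symm h0.ge) h.not_ge

section Generators

variable {s t : ℚ} {M : Bool → GL (Fin 2) ℚ}

/-- The image of a letter of the free group. -/
def letterImage (M : Bool → GL (Fin 2) ℚ) (a : Bool × Bool) : GL (Fin 2) ℚ :=
  cond a.2 (M a.1) (M a.1)⁻¹

lemma intervalForm_letterImage (hs : 0 < s) (hst : s < t - 1)
    (hM₁ : (M true).val = !![t - 1, s; 1, 1]) (hM₂ : (M false).val = !![s, s; 1, t - s])
    (a : Bool × Bool) : ∃ c > 0, ∀ w,
      intervalForm s a ((letterImage M a).val *ᵥ w) = -c * intervalForm s (a.1, !a.2) w := by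
  have hd : 0 < t - 1 - s := by linarith
  have hpos : ∀ b, ∃ c > 0, ∀ w,
      intervalForm s (b, true) ((M b).val *ᵥ w) = -c * intervalForm s (b, false) w := by
    intro b
    cases b
    · refine ⟨s ^ 2 * (t - 1 - s), by positivity, fun w => ?_⟩
      simp [hM₂, intervalForm, mulVec, dotProduct, Fin.sum_univ_two]
      ring
    · refine ⟨t - 1 - s, hd, fun w => ?_⟩
      simp [hM₁, intervalForm, mulVec, dotProduct, Fin.sum_univ_two]
      ring
  obtain ⟨b, e⟩ := a
  obtain ⟨c, hc, h⟩ := hpos b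
  cases e
  · refine ⟨c⁻¹, by positivity, fun w => ?_⟩
    have := h ((M b)⁻¹.val *ᵥ w)
    rw [mulVec_mulVec, ← Units.val_mul, mul_inv_cancel, Units.val_one, one_mulVec] at this
    simp only [letterImage, cond_false, Bool.not_false, this]
    field_simp
  · exact ⟨c, hc, h⟩

/-- Ping-pong: a reduced word maps the complement of the interval of its last letter's inverse into
the interval of its first letter. -/
lemma intervalForm_word (hs : 0 < s) (hst : s < t - 1)
    (hM₁ : (M true).val = !![t - 1, s; 1, 1]) (hM₂ : (M false).val = !![s, s; 1, t - s])
    (L : List (Bool × Bool)) (hL : FreeGroup.IsReduced L) :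
    ∀ a ∈ L.head?, ∀ b ∈ L.getLast?, ∀ w,
      (intervalForm s (b.1, !b.2) w < 0 →
        0 < intervalForm s a ((L.map (letterImage M)).prod.val *ᵥ w)) ∧
      (intervalForm s (b.1, !b.2) w ≤ 0 →
        0 ≤ intervalForm s a ((L.map (letterImage M)).prod.val *ᵥ w)) := by
  induction L with
  | nil => simp
  | cons x L ih =>
    rintro a ha b hb w
    obtain rfl : x = a := by simpa using ha
    obtain ⟨c, hc, h⟩ := intervalForm_letterImage hs hst hM₁ hM₂ x
    cases L with
    | nil =>
      obtain rfl : x = b := by simpa using hb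
      simp only [List.map_cons, List.map_nil, List.prod_cons, List.prod_nil, mul_one, h]
      constructor <;> intro _ <;> nlinarith
    | cons y L =>
      rw [FreeGroup.isReduced_cons_cons] at hL
      have hb' : b ∈ (y :: L).getLast? := by simpa using hb
      have hne : y ≠ (x.1, !x.2) := by
        rintro rfl
        simpa using hL.1
      obtain ⟨i1, i2⟩ := ih hL.2 y (by simp) b hb' w
      rw [List.map_cons, List.prod_cons, Units.val_mul, ← mulVec_mulVec, h]
      constructor
      · intro hw
        have := intervalForm_neg_of_pos hs hne (i1 hw)
        nlinarith
      · intro hw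
        have := intervalForm_nonpos_of_nonneg hs hne (i2 hw)
        nlinarith

/-- No nonscalar element with `tr² = 4 det` given by a cyclically reduced word fixes a point that is
not an endpoint of the four intervals. -/
lemma not_parabolic_of_isCyclicallyReduced (hs : 0 < s) (hst : s < t - 1)
    (hM₁ : (M true).val = !![t - 1, s; 1, 1]) (hM₂ : (M false).val = !![s, s; 1, t - s])
    {L : List (Bool × Bool)} (hL : FreeGroup.IsCyclicallyReduced L)
    {B : GL (Fin 2) ℚ} (hB : B = (L.map (letterImage M)).prod)
    (htr : B.val.trace ^ 2 = 4 * B.val.det)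
    (hns : ¬ (B.val 0 0 = B.val 1 1 ∧ B.val 0 1 = 0 ∧ B.val 1 0 = 0))
    {v : Fin 2 → ℚ} (hv : v 1 ≠ 0) (hform : ∀ a, intervalForm s a v ≠ 0)
    {μ : ℚ} (hfix : B.val *ᵥ v = μ • v) : False := by
  have hdet : B.val.det ≠ 0 := (B.isUnit.map Matrix.detMonoidHom).ne_zero
  have hword := intervalForm_word hs hst hM₁ hM₂ L hL.1
  rw [← hB] at hword
  cases hh : L.head? with
  | none =>
    rw [List.head?_eq_none_iff] at hh
    subst hh
    exact hns (by simp [hB])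
  | some a =>
  cases hb : L.getLast? with
  | none =>
    rw [List.getLast?_eq_none_iff] at hb
    simp [hb] at hh
  | some b =>
  have hne : a ≠ (b.1, !b.2) := by
    rintro rfl
    simpa using hL.2 b hb _ hh
  replace hword := hword a hh b hb
  rcases (hform (b.1, !b.2)).lt_or_gt with hneg | hpos
  · obtain ⟨e, f, hq⟩ := intervalForm_eq_endpoints s (b.1, !b.2)
    exact parabolic_not_contracting hq htr hns hv hfix hneg fun w hw =>
      intervalForm_neg_of_pos hs hne ((hword w).1 hw)
  · obtain ⟨e, f, hq⟩ := intervalForm_eq_endpoints s a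
    have hadj : B.val.adjugate *ᵥ v = (B.val.trace - μ) • v := by
      have : B.val.adjugate = B.val.trace • (1 : Matrix (Fin 2) (Fin 2) ℚ) - B.val := by
        ext i j
        fin_cases i <;> fin_cases j <;> simp [adjugate_fin_two, trace_fin_two]
      rw [this, sub_mulVec, smul_mulVec, one_mulVec, hfix, sub_smul]
    refine parabolic_not_contracting (B := B.val.adjugate) hq ?_ ?_ hv hadj
      (intervalForm_neg_of_pos hs hne.symm hpos) fun w hw => ?_
    · rw [det_adjugate]
      simpa [adjugate_fin_two, trace_fin_two, add_comm] using htr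
    · rintro ⟨h1, h2, h3⟩
      simp only [adjugate_fin_two, of_apply, cons_val', cons_val_zero, cons_val_one,
        cons_val_fin_one, neg_eq_zero] at h1 h2 h3
      exact hns ⟨h1.symm, h2, h3⟩
    · refine intervalForm_neg_of_pos hs hne.symm (not_le.mp fun hle => ?_)
      have := (hword _).2 hle
      rw [mulVec_mulVec, mul_adjugate, smul_mulVec, one_mulVec, intervalForm_smul] at this
      exact absurd this (not_le.mpr (mul_neg_of_pos_of_neg (by positivity) hw))

end Generators

section Padic

variable {p : ℕ} [Fact p.Prime]

/-- The ratio of the two homogeneous coordinates has `p`-adic norm `p`. -/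
def HasNormRatio (p : ℕ) [Fact p.Prime] (v : Fin 2 → ℚ) : Prop :=
  v 1 ≠ 0 ∧ ‖(v 0 : ℚ_[p])‖ = p * ‖(v 1 : ℚ_[p])‖

lemma HasNormRatio.smul {v : Fin 2 → ℚ} (hv : HasNormRatio p v) {c : ℚ} (hc : c ≠ 0) :
    HasNormRatio p (c • v) := by
  refine ⟨by simpa using ⟨hc, hv.1⟩, ?_⟩
  simp [hv.2]
  ring

lemma padic_norm_add_of_lt {a b : ℚ_[p]} (h : ‖b‖ < ‖a‖) : ‖a + b‖ = ‖a‖ := by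
  rw [IsUltrametricDist.norm_add_eq_max_of_norm_ne_norm h.ne', max_eq_left h.le]

lemma HasNormRatio.intervalForm_ne_zero {v : Fin 2 → ℚ} (hv : HasNormRatio p v)
    (a : Bool × Bool) : intervalForm (1 / (p : ℚ) ^ 2) a v ≠ 0 := by
  have hp : (1 : ℝ) < p := by exact_mod_cast (Fact.out : p.Prime).one_lt
  have hn : 0 < ‖(v 1 : ℚ_[p])‖ := norm_pos_iff.mpr (Rat.cast_ne_zero.mpr hv.1)
  have h1 := hv.1
  have h0 : v 0 ≠ 0 := by
    intro h
    have := hv.2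
    rw [h, Rat.cast_zero, norm_zero] at this
    nlinarith
  have hadd : v 0 + v 1 ≠ 0 := by
    intro h
    have h' : v 0 = -v 1 := by linarith
    have := hv.2
    rw [h'] at this
    simp only [Rat.cast_neg, norm_neg] at this
    nlinarith
  have hsub : v 0 - 1 / (p : ℚ) ^ 2 * v 1 ≠ 0 := by
    intro h
    have h' : v 0 = 1 / (p : ℚ) ^ 2 * v 1 := by linarith
    have := hv.2
    rw [h'] at this
    have e : ‖((1 / (p : ℚ) ^ 2 : ℚ) : ℚ_[p])‖ = p ^ 2 := by simp
    rw [Rat.cast_mul, norm_mul, e] at this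
    have := mul_right_cancel₀ hn.ne' this
    nlinarith
  have hsub' : 1 / (p : ℚ) ^ 2 * v 1 - v 0 ≠ 0 := by
    rw [← neg_sub]; exact neg_ne_zero.mpr hsub
  match a with
  | (true, true) => exact mul_ne_zero h1 hsub
  | (true, false) => exact mul_ne_zero (neg_ne_zero.mpr h0) hadd
  | (false, true) => exact mul_ne_zero h0 hsub'
  | (false, false) => exact mul_ne_zero (neg_ne_zero.mpr h1) hadd

lemma HasNormRatio.of_dominant {v : Fin 2 → ℚ} {n : ℝ} (hn : 0 < n) {a b c d : ℚ}
    (h0 : v 0 = a + b) (h1 : v 1 = c + d) (ha : ‖(a : ℚ_[p])‖ = p * n) (hb : ‖(b : ℚ_[p])‖ < p * n)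
    (hc : ‖(c : ℚ_[p])‖ = n) (hd : ‖(d : ℚ_[p])‖ < n) : HasNormRatio p v := by
  have e0 : ‖(v 0 : ℚ_[p])‖ = p * n := by
    rw [h0, Rat.cast_add, padic_norm_add_of_lt (hb.trans_eq ha.symm), ha]
  have e1 : ‖(v 1 : ℚ_[p])‖ = n := by
    rw [h1, Rat.cast_add, padic_norm_add_of_lt (hd.trans_eq hc.symm), hc]
  refine ⟨fun h => ?_, by rw [e0, e1]⟩
  simp [h] at e1
  exact hn.ne e1

lemma HasNormRatio.letterImage {t : ℤ} {M : Bool → GL (Fin 2) ℚ}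
    (hM₁ : (M true).val = !![(t : ℚ) - 1, 1 / (p : ℚ) ^ 2; 1, 1])
    (hM₂ : (M false).val = !![1 / (p : ℚ) ^ 2, 1 / (p : ℚ) ^ 2; 1, t - 1 / (p : ℚ) ^ 2])
    (a : Bool × Bool) {v : Fin 2 → ℚ} (hv : HasNormRatio p v) :
    HasNormRatio p ((_root_.letterImage M a).val *ᵥ v) := by
  have hp : (1 : ℝ) < p := by exact_mod_cast (Fact.out : p.Prime).one_lt
  obtain ⟨n, hn⟩ : ∃ n, n = ‖(v 1 : ℚ_[p])‖ := ⟨_, rfl⟩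
  have hn0 : 0 < n := hn ▸ norm_pos_iff.mpr (Rat.cast_ne_zero.mpr hv.1)
  have hx := hv.2
  rw [← hn] at hx
  have hint : ∀ (k : ℤ) (x : ℚ_[p]), ‖(k : ℚ_[p]) * x‖ ≤ ‖x‖ := fun k x => by
    rw [norm_mul]
    exact mul_le_of_le_one_left (norm_nonneg _) (Padic.norm_int_le_one k)
  have ht1 := hint (t - 1)
  have ht := hint t
  push_cast at ht1
  have hpn : n < p * n := by nlinarith
  have hppn : p * n < p * (p * n) := by nlinarith
  have hpppn : p * (p * n) < p * (p * (p * n)) := by nlinarith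
  have hinv : ∀ b, ∀ w, (M b)⁻¹.val *ᵥ w = (M b).val.det⁻¹ • ((M b).val.adjugate *ᵥ w) := by
    intro b w
    rw [coe_units_inv, inv_def, Ring.inverse_eq_inv', smul_mulVec]
  have hdet : ∀ b, (M b).val.det⁻¹ ≠ 0 := fun b =>
    inv_ne_zero ((M b).isUnit.map Matrix.detMonoidHom).ne_zero
  match a with
  | (true, true) =>
    refine HasNormRatio.of_dominant (n := p * n) (a := 1 / (p : ℚ) ^ 2 * v 1) (b := (t - 1) * v 0)
      (c := v 0) (d := v 1) (by positivity) ?_ ?_ ?_ ?_ ?_ ?_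
    · simp [_root_.letterImage, hM₁, mulVec, dotProduct, Fin.sum_univ_two]; ring
    · simp [_root_.letterImage, hM₁, mulVec, dotProduct, Fin.sum_univ_two]
    · simp [← hn]; ring
    · push_cast; exact (ht1 _).trans_lt (by rwa [hx])
    · exact hx
    · rwa [← hn]
  | (false, true) =>
    refine HasNormRatio.of_dominant (n := p * (p * n)) (a := 1 / (p : ℚ) ^ 2 * v 0)
      (b := 1 / (p : ℚ) ^ 2 * v 1)
      (c := - (1 / (p : ℚ) ^ 2 * v 1)) (d := v 0 + t * v 1) (by positivity) ?_ ?_ ?_ ?_ ?_ ?_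
    · simp [_root_.letterImage, hM₂, mulVec, dotProduct, Fin.sum_univ_two]
    · simp [_root_.letterImage, hM₂, mulVec, dotProduct, Fin.sum_univ_two]; ring
    · simp [hx]; ring
    · simp [← hn]; nlinarith
    · simp [← hn]; ring
    · push_cast
      rw [padic_norm_add_of_lt, hx]
      · exact hppn
      · rw [hx]; exact (ht _).trans_lt (by rwa [← hn])
  | (true, false) =>
    change HasNormRatio p ((M true)⁻¹.val *ᵥ v)
    rw [hinv]
    refine HasNormRatio.smul ?_ (hdet _)
    refine HasNormRatio.of_dominant (n := p * n) (a := -(1 / (p : ℚ) ^ 2 * v 1)) (b := v 0)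
      (c := -v 0) (d := (t - 1) * v 1) (by positivity) ?_ ?_ ?_ ?_ ?_ ?_
    · simp [hM₁, adjugate_fin_two, mulVec, dotProduct, Fin.sum_univ_two]; ring
    · simp [hM₁, adjugate_fin_two, mulVec, dotProduct, Fin.sum_univ_two]
    · simp [← hn]; ring
    · rwa [hx]
    · simpa using hx
    · push_cast; exact (ht1 _).trans_lt (by rwa [← hn])
  | (false, false) =>
    change HasNormRatio p ((M false)⁻¹.val *ᵥ v)
    rw [hinv]
    refine HasNormRatio.smul ?_ (hdet _)
    refine HasNormRatio.of_dominant (n := p * (p * n)) (a := -(1 / (p : ℚ) ^ 2 * v 0))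
      (b := t * v 0 + -(1 / (p : ℚ) ^ 2 * v 1))
      (c := 1 / (p : ℚ) ^ 2 * v 1) (d := -v 0) (by positivity) ?_ ?_ ?_ ?_ ?_ ?_
    · simp [hM₂, adjugate_fin_two, mulVec, dotProduct, Fin.sum_univ_two]; ring
    · simp [hM₂, adjugate_fin_two, mulVec, dotProduct, Fin.sum_univ_two]; ring
    · simp [hx]; ring
    · have e : ‖(((-(1 / (p : ℚ) ^ 2 * v 1)) : ℚ) : ℚ_[p])‖ = p * (p * n) := by
        simp [← hn]; ring
      rw [Rat.cast_add, add_comm, padic_norm_add_of_lt, e]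
      · exact hpppn
      · rw [e]; push_cast; exact (ht _).trans_lt (by rwa [hx])
    · simp [← hn]; ring
    · simpa [hx] using hppn

lemma HasNormRatio.word {t : ℤ} {M : Bool → GL (Fin 2) ℚ}
    (hM₁ : (M true).val = !![(t : ℚ) - 1, 1 / (p : ℚ) ^ 2; 1, 1])
    (hM₂ : (M false).val = !![1 / (p : ℚ) ^ 2, 1 / (p : ℚ) ^ 2; 1, t - 1 / (p : ℚ) ^ 2])
    (L : List (Bool × Bool)) {v : Fin 2 → ℚ} (hv : HasNormRatio p v) :
    HasNormRatio p ((L.map (_root_.letterImage M)).prod.val *ᵥ v) := by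
  induction L with
  | nil => simpa
  | cons a L ih =>
    rw [List.map_cons, List.prod_cons, Units.val_mul, ← mulVec_mulVec]
    exact ih.letterImage hM₁ hM₂ a

end Padic

lemma scalar_of_conj_scalar {C B : GL (Fin 2) ℚ}
    (h : (C⁻¹ * B * C).val 0 0 = (C⁻¹ * B * C).val 1 1 ∧ (C⁻¹ * B * C).val 0 1 = 0 ∧
      (C⁻¹ * B * C).val 1 0 = 0) : B ∈ Subgroup.center (GL (Fin 2) ℚ) := by
  have hc : C⁻¹ * B * C ∈ Subgroup.center (GL (Fin 2) ℚ) := by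
    rw [GeneralLinearGroup.mem_center_iff_val_mem_range_scalar]
    refine ⟨(C⁻¹ * B * C).val 0 0, ?_⟩
    ext i j
    fin_cases i <;> fin_cases j <;> simp_all
  have := Subgroup.Normal.conj_mem inferInstance _ hc C
  simpa [mul_assoc] using this

/-- No rational of `p`-adic norm `p` is a cusp of `Δ(p⁻²,2t)`. -/
lemma notMem_finiteCusps_of_norm_eq (p : ℕ) [Fact p.Prime] (t : ℤ) (ht : 2 ≤ t) {x : ℚ}
    (hx : ‖(x : ℚ_[p])‖ = p) : x ∉ finiteCusps (Delta (1 / (p : ℚ) ^ 2) (t : ℚ)) := by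
  rintro ⟨A, hA, hA1, htr, hfix⟩
  have hp : (1 : ℚ) < p := by exact_mod_cast (Fact.out : p.Prime).one_lt
  have htq : (2 : ℚ) ≤ t := by exact_mod_cast ht
  obtain ⟨s, hs⟩ : ∃ s, s = 1 / (p : ℚ) ^ 2 := ⟨_, rfl⟩
  have hs0 : 0 < s := by rw [hs]; positivity
  have hs1 : s < 1 := by
    rw [hs, div_lt_one (by positivity)]; nlinarith
  have hst : s < t - 1 := by linarith
  let M : Bool → GL (Fin 2) ℚ := fun b => cond b
    (GeneralLinearGroup.mkOfDetNeZero !![(t : ℚ) - 1, s; 1, 1] (by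
      rw [det_fin_two_of]; linarith))
    (GeneralLinearGroup.mkOfDetNeZero !![s, s; 1, t - s] (by
      rw [det_fin_two_of]; nlinarith))
  have hM₁ : (M true).val = !![(t : ℚ) - 1, s; 1, 1] := rfl
  have hM₂ : (M false).val = !![s, s; 1, t - s] := rfl
  have hlift : ∀ L, FreeGroup.lift M (FreeGroup.mk L) = (L.map (letterImage M)).prod :=
    fun L => FreeGroup.lift_mk
  obtain ⟨w, hw⟩ : pgl A ∈ (pgl.comp (FreeGroup.lift M)).range := by
    refine (Subgroup.closure_le _).mpr ?_ hA
    rintro _ ⟨B, hB, rfl⟩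
    rw [← hs] at hB
    rcases hB with hB | hB
    · exact ⟨FreeGroup.of true, congrArg pgl (by
        rw [FreeGroup.lift_apply_of]; exact Units.ext (hM₁.trans hB.symm))⟩
    · exact ⟨FreeGroup.of false, congrArg pgl (by
        rw [FreeGroup.lift_apply_of]; exact Units.ext (hM₂.trans hB.symm))⟩
  set B := FreeGroup.lift M w with hBdef
  have hBc : B ∉ Subgroup.center (GL (Fin 2) ℚ) := by
    intro h
    apply hA1
    rw [← hw]
    exact (QuotientGroup.eq_one_iff _).mpr h
  obtain ⟨r, hr⟩ : ∃ r : ℚ, B.val = r • A.val := by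
    have : A⁻¹ * B ∈ Subgroup.center (GL (Fin 2) ℚ) := QuotientGroup.eq.mp hw.symm
    obtain ⟨r, hr⟩ := GeneralLinearGroup.mem_center_iff_val_mem_range_scalar.mp this
    refine ⟨r, ?_⟩
    calc B.val = A.val * (A⁻¹ * B).val := by rw [← Units.val_mul, mul_inv_cancel_left]
      _ = r • A.val := by
        rw [← hr]; ext i j; simp [scalar_apply, mul_comm]
  have htrB : B.val.trace ^ 2 = 4 * B.val.det := by
    rw [hr, trace_smul, det_smul, Fintype.card_fin, smul_eq_mul]
    linear_combination r ^ 2 * htr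
  obtain ⟨μ, hμ⟩ : ∃ μ : ℚ, B.val *ᵥ ![x, 1] = μ • ![x, 1] := by
    change (if A.val 1 0 * x + A.val 1 1 = 0 then OnePoint.infty
      else (((A.val 0 0 * x + A.val 0 1) / (A.val 1 0 * x + A.val 1 1) : ℚ) : OnePoint ℚ)) = x
      at hfix
    split_ifs at hfix with h
    · exact absurd hfix (OnePoint.infty_ne_coe x)
    · rw [OnePoint.coe_eq_coe, div_eq_iff h] at hfix
      refine ⟨r * (A.val 1 0 * x + A.val 1 1), ?_⟩
      rw [hr]
      ext i
      fin_cases i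
      · simp [mulVec, dotProduct, Fin.sum_univ_two]
        linear_combination r * hfix
      · simp [mulVec, dotProduct, Fin.sum_univ_two]
        ring
  have hv : HasNormRatio p ![x, 1] := ⟨by simp, by simpa using hx⟩
  obtain ⟨L, hL⟩ : ∃ L, L = FreeGroup.reduceCyclically w.toWord := ⟨_, rfl⟩
  obtain ⟨K, hK⟩ : ∃ K, K = FreeGroup.reduceCyclically.conjugator w.toWord := ⟨_, rfl⟩
  have hwKL : w = FreeGroup.mk K * FreeGroup.mk L * (FreeGroup.mk K)⁻¹ := by
    rw [FreeGroup.inv_mk, FreeGroup.mul_mk, FreeGroup.mul_mk, hK, hL,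
      FreeGroup.reduceCyclically.conj_conjugator_reduceCyclically, FreeGroup.mk_toWord]
  set C := FreeGroup.lift M (FreeGroup.mk K) with hC
  have hconj : (L.map (letterImage M)).prod = C⁻¹ * B * C := by
    have : B = C * FreeGroup.lift M (FreeGroup.mk L) * C⁻¹ := by
      rw [hBdef, hC, ← map_inv, ← map_mul, ← map_mul, ← hwKL]
    rw [← hlift, this]
    group
  have hCinv : C⁻¹ = ((FreeGroup.invRev K).map (letterImage M)).prod := by
    rw [← hlift, ← FreeGroup.inv_mk, map_inv]
  have hv' : HasNormRatio p (C⁻¹.val *ᵥ ![x, 1]) := by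
    rw [hCinv]
    exact hv.word (by rw [← hs]; exact hM₁) (by rw [← hs]; exact hM₂) _
  refine not_parabolic_of_isCyclicallyReduced hs0 hst hM₁ hM₂
    (hL ▸ FreeGroup.reduceCyclically.isCyclicallyReduced FreeGroup.isReduced_toWord)
    hconj.symm ?_ (fun h => hBc (scalar_of_conj_scalar h)) hv'.1
    (fun a => hs ▸ hv'.intervalForm_ne_zero a) (μ := μ) ?_
  · have h1 : (C⁻¹ * B * C).val.trace = B.val.trace := by
      rw [Units.val_mul, trace_mul_comm, ← Units.val_mul, mul_inv_cancel_left]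
    have h2 : (C⁻¹ * B * C).val.det = B.val.det := by
      rw [Units.val_mul, det_mul_comm, ← Units.val_mul, mul_inv_cancel_left]
    rw [h1, h2, htrB]
  · rw [mulVec_mulVec, ← Units.val_mul, mul_assoc, mul_inv_cancel, mul_one, Units.val_mul,
      ← mulVec_mulVec, hμ, mulVec_smul]

/-- **Theorem 2.** Let `p` be a prime and `t ≥ 2` an integer, and set
`u² = 1/p²`. Then the finite cusp set of `Δ(p⁻²,2t)` is not dense in `ℚ_p`; in particular it
is a proper subset of `ℚ`, so `Δ(p⁻²,2t)` is neither pseudomodular nor arithmetic. -/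
theorem delta_one_div_p_sq_not_pseudomodular (p : ℕ) [Fact p.Prime] (t : ℤ) (ht : 2 ≤ t) :
    ¬ Dense ((fun x : ℚ => (x : ℚ_[p])) ''
        finiteCusps (Delta (1 / (p : ℚ) ^ 2) (t : ℚ))) ∧
      finiteCusps (Delta (1 / (p : ℚ) ^ 2) (t : ℚ)) ≠ Set.univ := by
  have hp0 : (p : ℝ) ≠ 0 := by exact_mod_cast (Fact.out : p.Prime).ne_zero
  have hnorm : ‖((1 / p : ℚ) : ℚ_[p])‖ = p := by simp
  refine ⟨fun hd => ?_, fun h => ?_⟩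
  · obtain ⟨_, hz, x, hx, rfl⟩ := hd.inter_open_nonempty (Metric.sphere (0 : ℚ_[p]) p)
      (IsUltrametricDist.isOpen_sphere _ hp0) ⟨_, mem_sphere_zero_iff_norm.mpr hnorm⟩
    exact notMem_finiteCusps_of_norm_eq p t ht (mem_sphere_zero_iff_norm.mp hz) hx
  · exact notMem_finiteCusps_of_norm_eq p t ht hnorm (h ▸ Set.mem_univ _)
end
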